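/- Fix an integer r ≥ 1 and n ≥ 2r. There is a constant C_r > 0 depending only on r such that for every σ > 0, every V ≥ 0 and every θ* ∈ ℝ^n, the constrained trend filtering estimator θ̂^{(r)}_V satisfies R(θ̂^{(r)}_V, θ*) ≤ inf over θ ∈ ℝ^n with V^{(r)}(θ) = V of [ (1/n)‖θ* − θ‖² + C_r σ² Δ_r(θ) ]. -/

import Mathlib

open MeasureTheory ProbabilityTheory
open scoped BigOperators

noncomputable section

/-- Zero-padding of a finite vector to a sequence on `ℕ`. -/
def pad {n : ℕ} (θ : Fin n → ℝ) : ℕ → ℝ := fun t => if h : t < n then θ ⟨t, h⟩ else 0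

/-- First-order forward difference of a sequence. -/
def dseq (f : ℕ → ℝ) : ℕ → ℝ := fun t => f (t + 1) - f t

/-- `DD r θ t` is the `t`-th entry (0-indexed) of the `r`-th order difference `D^{(r)} θ`
of the vector `θ ∈ ℝ^n`; only the entries `t < n - r` are meaningful. -/
def DD (r : ℕ) {n : ℕ} (θ : Fin n → ℝ) : ℕ → ℝ := dseq^[r] (pad θ)

/-- The ℓ¹ norm `‖D^{(r)} θ‖₁`. -/
def Dl1 (r : ℕ) {n : ℕ} (θ : Fin n → ℝ) : ℝ := ∑ t ∈ Finset.range (n - r), |DD r θ t|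

/-- The number of nonzero entries `‖D^{(r)} θ‖₀`. -/
def Dl0 (r : ℕ) {n : ℕ} (θ : Fin n → ℝ) : ℕ :=
  ((Finset.range (n - r)).filter fun t => DD r θ t ≠ 0).card

/-- Squared Euclidean norm. -/
def sqnorm {n : ℕ} (x : Fin n → ℝ) : ℝ := ∑ i, x i ^ 2

/-- Euclidean norm. -/
def eunorm {n : ℕ} (x : Fin n → ℝ) : ℝ := Real.sqrt (sqnorm x)

/-- `V^{(r)}(θ) = n^{r-1} ‖D^{(r)} θ‖₁`. -/
def Vr (r : ℕ) {n : ℕ} (θ : Fin n → ℝ) : ℝ := (n : ℝ) ^ ((r : ℤ) - 1) * Dl1 r θ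

/-- The constraint set `K^{(r)}(V) = {θ : ‖D^{(r)} θ‖₁ ≤ V n^{1-r}}`. -/
def Kset (r n : ℕ) (V : ℝ) : Set (Fin n → ℝ) := {θ | Dl1 r θ ≤ V * (n : ℝ) ^ (1 - (r : ℤ))}

/-- `est` is a least-squares projection onto the set `K`. -/
def IsProjOn {n : ℕ} (est : (Fin n → ℝ) → Fin n → ℝ) (K : Set (Fin n → ℝ)) : Prop :=
  ∀ y, est y ∈ K ∧ ∀ θ ∈ K, sqnorm (y - est y) ≤ sqnorm (y - θ)

/-- `est` is the penalized trend filtering estimator of order `r` with noise level `σ`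
and tuning parameter `lam`: it minimizes `½‖y - θ‖² + σ n^{r-1} lam ‖D^{(r)} θ‖₁`. -/
def IsPenEst (r : ℕ) {n : ℕ} (σ lam : ℝ) (est : (Fin n → ℝ) → Fin n → ℝ) : Prop :=
  ∀ y θ, 1 / 2 * sqnorm (y - est y) + σ * (n : ℝ) ^ ((r : ℤ) - 1) * lam * Dl1 r (est y) ≤
    1 / 2 * sqnorm (y - θ) + σ * (n : ℝ) ^ ((r : ℤ) - 1) * lam * Dl1 r θ

/-- The Gaussian measure `N_n(0, σ² I_n)` on `ℝ^n`. -/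
def gaussVec (n : ℕ) (σ : ℝ) : Measure (Fin n → ℝ) :=
  Measure.pi fun _ => gaussianReal 0 (σ ^ 2).toNNReal

/-- The risk `R(θ̂, θ*) = (1/n) E ‖θ̂(θ* + ξ) - θ*‖²` for `ξ ∼ N_n(0, σ² I_n)`. -/
def risk {n : ℕ} (σ : ℝ) (est : (Fin n → ℝ) → Fin n → ℝ) (θs : Fin n → ℝ) : ℝ :=
  1 / (n : ℝ) * ∫ ξ, sqnorm (est (θs + ξ) - θs) ∂gaussVec n σ

/-- `j` (with signs `sg`) enumerates, in increasing order and paper (1-indexed) convention,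
exactly the `r`-th order knots of `θ ∈ ℝ^n`; an index `2 ≤ m ≤ n - r + 1` is a knot when
`(D^{(r-1)}θ)_{m-1} ≠ (D^{(r-1)}θ)_m` (1-indexed entries), and its sign is `+1` when
`(D^{(r-1)}θ)_{m-1} < (D^{(r-1)}θ)_m` and `-1` otherwise. -/
def IsKnotSeq (r n : ℕ) (θ : Fin n → ℝ) (k : ℕ) (j : Fin k → ℕ) (sg : Fin k → ℝ) : Prop :=
  StrictMono j ∧ (∀ i, 2 ≤ j i ∧ j i ≤ n - r + 1) ∧
    (∀ m : ℕ, 2 ≤ m → m ≤ n - r + 1 →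
      (DD (r - 1) θ (m - 2) ≠ DD (r - 1) θ (m - 1) ↔ ∃ i, j i = m)) ∧
    ∀ i, sg i = if DD (r - 1) θ (j i - 2) < DD (r - 1) θ (j i - 1) then 1 else -1

/-- Extended knot sequence: `jext 0 = j_0 = 1`, `jext i = j_i` for `1 ≤ i ≤ k`, and
`jext (k+1) = j_{k+1} = n - r + 2`. -/
def jext (n r k : ℕ) (j : Fin k → ℕ) : ℕ → ℕ := fun i =>
  if i = 0 then 1 else if h : i - 1 < k then j ⟨i - 1, h⟩ else n - r + 2

/-- Extended sign sequence: `sgext i = 𝔯_i` for `1 ≤ i ≤ k` and `0` otherwise. -/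
def sgext (k : ℕ) (sg : Fin k → ℝ) : ℕ → ℝ := fun i =>
  if h : 0 < i ∧ i - 1 < k then sg ⟨i - 1, h.2⟩ else 0

/-- The lengths `n_0 = j_1 + r - 2`, `n_i = j_{i+1} - j_i` (`1 ≤ i ≤ k-1`),
`n_k = n - r + 2 - j_k`. -/
def nlen (n r k : ℕ) (j : Fin k → ℕ) : ℕ → ℕ := fun i =>
  if i = 0 then jext n r k j 1 + r - 2 else jext n r k j (i + 1) - jext n r k j i

/-- `n_{i*} = min(n_i, n/(k+1))`. -/
def nstar (n r k : ℕ) (j : Fin k → ℕ) (i : ℕ) : ℝ :=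
  min (nlen n r k j i : ℝ) ((n : ℝ) / ((k : ℝ) + 1))

/-- `δ_r(θ)²` defined from the knot data of `θ`. -/
def deltaSq (n r k : ℕ) (j : Fin k → ℕ) (sg : Fin k → ℝ) : ℝ :=
  nstar n r k j 0 ^ (1 - 2 * (r : ℤ)) + nstar n r k j k ^ (1 - 2 * (r : ℤ)) +
    ∑ i ∈ Finset.Ico 1 k,
      if sgext k sg i ≠ sgext k sg (i + 1) then nstar n r k j i ^ (1 - 2 * (r : ℤ)) else 0

/-- `Δ_r(θ)` defined from the knot data of `θ`. -/
def DeltaR (n r k : ℕ) (j : Fin k → ℕ) (sg : Fin k → ℝ) : ℝ :=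
  ((k : ℝ) + 1) / (n : ℝ) * Real.log (Real.exp 1 * (n : ℝ) / ((k : ℝ) + 1)) +
    deltaSq n r k j sg / (n : ℝ) * ((n : ℝ) / ((k : ℝ) + 1)) ^ (2 * (r : ℤ) - 1) *
      Real.log (Real.exp 1 * (n : ℝ) / ((k : ℝ) + 1)) +
    (Real.sqrt (deltaSq n r k j sg) / Real.sqrt (n : ℝ)) ^ ((1 : ℝ) / (r : ℝ))

/-- The minimum length condition with constant `c`: `n_i ≥ c n/(k+1)` for every `0 ≤ i ≤ k`
with `𝔯_i ≠ 𝔯_{i+1}` (where `𝔯_0 = 𝔯_{k+1} = 0`). -/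
def MinLen (n r k : ℕ) (j : Fin k → ℕ) (sg : Fin k → ℝ) (c : ℝ) : Prop :=
  ∀ i ≤ k, sgext k sg i ≠ sgext k sg (i + 1) →
    c * (n : ℝ) / ((k : ℝ) + 1) ≤ (nlen n r k j i : ℝ)

/-- The subdifferential of `g` at `θ`. -/
def subdiff {n : ℕ} (g : (Fin n → ℝ) → ℝ) (θ : Fin n → ℝ) : Set (Fin n → ℝ) :=
  {v | ∀ y, g θ + ∑ i, v i * (y i - θ i) ≤ g y}

/-- `v` is the minimum-norm element of `S`. -/
def IsMinNormIn {n : ℕ} (v : Fin n → ℝ) (S : Set (Fin n → ℝ)) : Prop :=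
  v ∈ S ∧ ∀ w ∈ S, eunorm v ≤ eunorm w

/-- `c • S`. -/
def scaleSet {n : ℕ} (c : ℝ) (S : Set (Fin n → ℝ)) : Set (Fin n → ℝ) := (c • ·) '' S

/-- The cone generated by `S`: `⋃_{c ≥ 0} c • S`. -/
def coneOf {n : ℕ} (S : Set (Fin n → ℝ)) : Set (Fin n → ℝ) := ⋃ c ∈ Set.Ici (0 : ℝ), scaleSet c S

/-- Euclidean distance from a point to a set. -/
def distSet {n : ℕ} (z : Fin n → ℝ) (S : Set (Fin n → ℝ)) : ℝ :=
  sInf ((fun v => eunorm (z - v)) '' S)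

/-- Gaussian mean squared distance `D(S) = E dist²(Z, S)`, `Z ∼ N_n(0, I_n)`. -/
def gaussMSD {n : ℕ} (S : Set (Fin n → ℝ)) : ℝ := ∫ z, distSet z S ^ 2 ∂gaussVec n 1

/-- `lam z` is, for each `z`, the minimizer over `λ ≥ 0` of `dist(z, λ S)`. -/
def IsLamFun {n : ℕ} (S : Set (Fin n → ℝ)) (lam : (Fin n → ℝ) → ℝ) : Prop :=
  ∀ z, 0 ≤ lam z ∧ ∀ μ : ℝ, 0 ≤ μ → distSet z (scaleSet (lam z) S) ≤ distSet z (scaleSet μ S)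

/-- Euclidean covering number of `K` at scale `ε`. -/
def covN {n : ℕ} (ε : ℝ) (K : Set (Fin n → ℝ)) : ℕ :=
  sInf {m : ℕ | ∃ a : Fin m → Fin n → ℝ, ∀ x ∈ K, ∃ i, eunorm (x - a i) ≤ ε}

/-- `K` `t`-shatters the (finite) index set `A`. -/
def fatShatters {n : ℕ} (K : Set (Fin n → ℝ)) (t : ℝ) (A : Finset (Fin n)) : Prop :=
  ∃ h : Fin n → ℝ, ∀ S : Finset (Fin n), S ⊆ A →
    ∃ θ ∈ K, (∀ i ∈ S, θ i ≤ h i) ∧ ∀ i ∈ A, i ∉ S → h i + t ≤ θ i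

/-- The fat shattering dimension `v(K, t)`. -/
def fatDim {n : ℕ} (K : Set (Fin n → ℝ)) (t : ℝ) : ℕ :=
  sSup {m : ℕ | ∃ A : Finset (Fin n), A.card = m ∧ fatShatters K t A}

/-- The tangent cone of `K` at `θ`. -/
def tanCone {n : ℕ} (K : Set (Fin n → ℝ)) (θ : Fin n → ℝ) : Set (Fin n → ℝ) :=
  closure {w | ∃ t : ℝ, 0 ≤ t ∧ ∃ η ∈ K, w = t • (η - θ)}

/-- `V_{a,b}(f) = Σ_{m=a+1}^{b} |f_m - f_{m-1}|` for the (paper 1-indexed) sequence whose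
`m`-th entry is `f (m-1)`. -/
def Vab (f : ℕ → ℝ) (a b : ℕ) : ℝ := ∑ t ∈ Finset.Ico (a - 1) (b - 1), |f (t + 1) - f t|

/-- `Acoef r n v j = Σ_{i=j}^n C(r+i-j-1, r-1) v_i` (paper 1-indexed). -/
def Acoef (r n : ℕ) (v : Fin n → ℝ) (jj : ℕ) : ℝ :=
  ∑ i : Fin n, (if jj ≤ i.1 + 1 then ((r + (i.1 + 1) - jj - 1).choose (r - 1) : ℝ) else 0) * v i

/-- The class `C_r({a_i}, {s_i})`. -/
def Cras (r n : ℕ) (a s : ℕ → ℝ) : Set (Fin n → ℝ) :=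
  {θ | (∀ i < r - 1, a i ≤ DD i θ 0 ∧ DD i θ 0 ≤ a i + s i) ∧
    a (r - 1) ≤ DD (r - 1) θ 0 ∧
    (∀ t : ℕ, t + 1 ≤ n - r → DD (r - 1) θ t ≤ DD (r - 1) θ (t + 1)) ∧
    DD (r - 1) θ (n - r) ≤ a (r - 1) + s (r - 1)}

/-- The class `C_r(a, V) = {θ : a ≤ (D^{(r-1)}θ)_1 ≤ ⋯ ≤ (D^{(r-1)}θ)_{n-r+1} ≤ a + V}`. -/
def CrMono (r n : ℕ) (a V : ℝ) : Set (Fin n → ℝ) :=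
  {θ | a ≤ DD (r - 1) θ 0 ∧
    (∀ t : ℕ, t + 1 ≤ n - r → DD (r - 1) θ t ≤ DD (r - 1) θ (t + 1)) ∧
    DD (r - 1) θ (n - r) ≤ a + V}


/-- Backward difference on integer sequences. -/
def bdL : Module.End ℝ (ℤ → ℝ) where
  toFun f := fun t => f t - f (t - 1)
  map_add' f g := by ext t; simp; ring
  map_smul' c f := by ext t; simp; ring

/-- Forward difference on integer sequences. -/
def fdL : Module.End ℝ (ℤ → ℝ) where
  toFun f := fun t => f (t + 1) - f t
  map_add' f g := by ext t; simp; ring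
  map_smul' c f := by ext t; simp; ring

lemma bdL_apply (f : ℤ → ℝ) (t : ℤ) : bdL f t = f t - f (t - 1) := rfl
lemma fdL_apply (f : ℤ → ℝ) (t : ℤ) : fdL f t = f (t + 1) - f t := rfl

lemma bd_succ (r : ℕ) (f : ℤ → ℝ) : (bdL ^ (r + 1)) f = (bdL ^ r) (bdL f) := by
  rw [pow_succ]; rfl
lemma bd_succ' (r : ℕ) (f : ℤ → ℝ) : (bdL ^ (r + 1)) f = bdL ((bdL ^ r) f) := by
  rw [pow_succ']; rfl
lemma fd_succ' (r : ℕ) (f : ℤ → ℝ) : (fdL ^ (r + 1)) f = fdL ((fdL ^ r) f) := by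
  rw [pow_succ']; rfl

lemma bd_zero_of_interval (r : ℕ) (f : ℤ → ℝ) (t : ℤ)
    (h : ∀ s, t - r ≤ s → s ≤ t → f s = 0) : (bdL ^ r) f t = 0 := by
  induction r generalizing t with
  | zero => simpa using h t (by simp) le_rfl
  | succ r ih =>
    rw [bd_succ', bdL_apply, ih t, ih (t - 1)]
    · simp
    · intro s h1 h2; apply h <;> push_cast <;> linarith
    · intro s h1 h2; apply h <;> push_cast <;> linarith

/-- Locality: differences of a function locally constant vanish (`r ≥ 1`). -/
lemma bd_zero_of_const (r : ℕ) (hr : 1 ≤ r) (f : ℤ → ℝ) (t : ℤ) (c : ℝ)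
    (h : ∀ s, t - r ≤ s → s ≤ t → f s = c) : (bdL ^ r) f t = 0 := by
  obtain ⟨r, rfl⟩ : ∃ q, r = q + 1 := ⟨r - 1, by omega⟩
  rw [bd_succ]
  apply bd_zero_of_interval
  intro s h1 h2
  rw [bdL_apply, h s (by push_cast; linarith) h2, h (s - 1) (by push_cast; linarith) (by linarith)]
  simp

lemma sbp_one (p : ℕ) (v z : ℤ → ℝ) (h0 : ∀ t < 0, z t = 0) (h1 : ∀ t, (p : ℤ) ≤ t → z t = 0) :
    ∑ t ∈ Finset.range p, fdL v t * z t = - ∑ i ∈ Finset.range (p + 1), v i * bdL z i := by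
  have e1 : ∑ i ∈ Finset.range (p + 1), v i * z i = ∑ i ∈ Finset.range p, v i * z i := by
    rw [Finset.sum_range_succ, h1 p le_rfl]; simp
  have e2 : ∑ i ∈ Finset.range (p + 1), v i * z (i - 1) = ∑ i ∈ Finset.range p, v (i + 1) * z i := by
    rw [Finset.sum_range_succ', h0]
    · simp
    · simp
  simp only [fdL_apply, bdL_apply, mul_sub, sub_mul, Finset.sum_sub_distrib]
  rw [e1, e2]; ring

lemma sbp (r p : ℕ) (u z : ℤ → ℝ) (h0 : ∀ t < 0, z t = 0) (h1 : ∀ t, (p : ℤ) ≤ t → z t = 0) :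
    ∑ t ∈ Finset.range p, (fdL ^ r) u t * z t
      = (-1) ^ r * ∑ i ∈ Finset.range (p + r), u i * (bdL ^ r) z i := by
  induction r generalizing p z with
  | zero => simp
  | succ r ih =>
    rw [fd_succ', sbp_one p _ z h0 h1, ih (p + 1) (bdL z)]
    · rw [bd_succ, pow_succ]
      have : p + 1 + r = p + (r + 1) := by ring
      rw [this]; ring
    · intro t ht; rw [bdL_apply, h0 t ht, h0 (t - 1) (by linarith)]; simp
    · intro t ht; push_cast at ht
      rw [bdL_apply, h1 t (by linarith), h1 (t - 1) (by linarith)]; simp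

lemma bd_sample_bound (r : ℕ) (α β M : ℝ) (hα : 0 ≤ α) (F : ℝ → ℝ)
    (hF : ContDiff ℝ (⊤ : ℕ∞) F) (hM : ∀ x, |iteratedDeriv r F x| ≤ M) (t : ℤ) :
    |(bdL ^ r) (fun s : ℤ => F (α * s + β)) t| ≤ α ^ r * M := by
  induction r generalizing F M with
  | zero => simpa using hM _
  | succ r ih =>
    rw [bd_succ]
    have e : bdL (fun s : ℤ => F (α * s + β)) =
        fun s : ℤ => (fun x => F x - F (x - α)) (α * s + β) := by
      ext s; rw [bdL_apply]; push_cast; ring_nf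
    rw [e]
    have hG : ContDiff ℝ (⊤ : ℕ∞) (fun x => F (x - α)) := hF.comp (contDiff_id.sub contDiff_const)
    have := ih (α * M) (fun x => F x - F (x - α)) (hF.sub hG) (by
      intro x
      have h1 : ContDiff ℝ r F := hF.of_le (by exact_mod_cast le_top)
      have h2 : ContDiff ℝ r (fun x => F (x - α)) := hG.of_le (by exact_mod_cast le_top)
      rw [iteratedDeriv_fun_sub h1.contDiffAt h2.contDiffAt, iteratedDeriv_comp_sub_const]
      have hd : Differentiable ℝ (iteratedDeriv r F) :=
        hF.differentiable_iteratedDeriv r (by exact_mod_cast WithTop.coe_lt_top _)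
      have := Convex.norm_image_sub_le_of_norm_deriv_le (f := iteratedDeriv r F) (C := M)
        (s := Set.univ) (x := x - α) (y := x) (fun y _ => hd y)
        (fun y _ => by rw [← iteratedDeriv_succ]; exact hM y) convex_univ trivial trivial
      rw [Real.norm_eq_abs, Real.norm_eq_abs] at this
      rw [show x - (x - α) = α by ring, abs_of_nonneg hα] at this
      linarith)
    rw [pow_succ, mul_assoc]; exact this

/-- The smooth transition function used for all constructions. -/
abbrev chi : ℝ → ℝ := Real.smoothTransition

lemma chi_deriv_bound (r : ℕ) : ∃ A : ℝ, 0 < A ∧ ∀ x, |iteratedDeriv r chi x| ≤ A := by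
  rcases Nat.eq_zero_or_pos r with rfl | hr
  · refine ⟨1, one_pos, fun x => ?_⟩
    simp only [iteratedDeriv_zero]
    rw [abs_of_nonneg (Real.smoothTransition.nonneg x)]; exact Real.smoothTransition.le_one x
  · have hc : Continuous (iteratedDeriv r chi) :=
      (Real.smoothTransition.contDiff (n := (⊤ : ℕ∞))).continuous_iteratedDeriv r
        (by exact_mod_cast le_top)
    obtain ⟨A, hA⟩ := (isCompact_Icc (a := (0:ℝ)) (b := 1)).exists_bound_of_continuousOn
      hc.continuousOn
    refine ⟨max A 1, by positivity, fun x => ?_⟩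
    by_cases hx : x ∈ Set.Icc (0:ℝ) 1
    · exact (hA x hx).trans (le_max_left _ _)
    · have h0 : iteratedDeriv r chi x = 0 := by
        rw [Set.mem_Icc, not_and_or, not_le, not_le] at hx
        rcases hx with hx | hx
        · have : chi =ᶠ[nhds x] fun _ => (0:ℝ) := by
            filter_upwards [Iio_mem_nhds hx] with y hy
            exact Real.smoothTransition.zero_of_nonpos (le_of_lt hy)
          rw [this.iteratedDeriv_eq r, iteratedDeriv_const]; simp
        · have : chi =ᶠ[nhds x] fun _ => (1:ℝ) := by
            filter_upwards [Ioi_mem_nhds hx] with y hy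
            exact Real.smoothTransition.one_of_one_le (le_of_lt hy)
          rw [this.iteratedDeriv_eq r, iteratedDeriv_const]; simp; omega
      rw [h0]; simp

lemma chi_half_le {x : ℝ} (h : x ≤ 1 / 2) : chi x ≤ 1 / 2 := by
  unfold chi Real.smoothTransition
  have hp := Real.smoothTransition.pos_denom x
  have := expNegInvGlue.monotone (show x ≤ 1 - x by linarith)
  rw [div_le_iff₀ hp]; linarith

lemma chi_half_ge {x : ℝ} (h : 1 / 2 ≤ x) : 1 / 2 ≤ chi x := by
  unfold chi Real.smoothTransition
  have hp := Real.smoothTransition.pos_denom x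
  have := expNegInvGlue.monotone (show 1 - x ≤ x by linarith)
  rw [le_div_iff₀ hp]; linarith

/-- Zero extension of a vector to `ℤ`. -/
def extZ {n : ℕ} (θ : Fin n → ℝ) : ℤ → ℝ := fun t => if 0 ≤ t then pad θ t.toNat else 0

lemma extZ_nat {n : ℕ} (θ : Fin n → ℝ) (t : ℕ) : extZ θ t = pad θ t := by simp [extZ]

lemma extZ_fin {n : ℕ} (θ : Fin n → ℝ) (i : Fin n) : extZ θ (i.1 : ℤ) = θ i := by
  rw [extZ_nat]; simp [pad]

lemma extZ_sub {n : ℕ} (θ η : Fin n → ℝ) : extZ (θ - η) = extZ θ - extZ η := by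
  ext t; simp only [extZ, pad, Pi.sub_apply]; split_ifs <;> simp

lemma fd_extZ (r : ℕ) {n : ℕ} (θ : Fin n → ℝ) (t : ℕ) : (fdL ^ r) (extZ θ) t = DD r θ t := by
  induction r generalizing t with
  | zero => simp [DD, extZ_nat]
  | succ r ih =>
    rw [fd_succ', fdL_apply, ih t]
    have := ih (t + 1)
    push_cast at this
    rw [this]
    simp only [DD, Function.iterate_succ_apply', dseq]

lemma DD_sub (r : ℕ) {n : ℕ} (θ η : Fin n → ℝ) (t : ℕ) :
    DD r (θ - η) t = DD r θ t - DD r η t := by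
  rw [← fd_extZ, extZ_sub, map_sub]; simp [fd_extZ]

lemma extZ_add_smul {n : ℕ} (θ η : Fin n → ℝ) (c : ℝ) :
    extZ (θ + c • η) = extZ θ + c • extZ η := by
  ext t; simp only [extZ, pad, Pi.add_apply, Pi.smul_apply, smul_eq_mul]; split_ifs <;> simp

lemma DD_add_smul (r : ℕ) {n : ℕ} (θ η : Fin n → ℝ) (c : ℝ) (t : ℕ) :
    DD r (θ + c • η) t = DD r θ t + c * DD r η t := by
  rw [← fd_extZ, extZ_add_smul, map_add, map_smul]; simp [fd_extZ]

lemma sum_fin_ext {n : ℕ} (f : ℤ → ℝ) : ∑ i : Fin n, f (i.1 : ℤ) = ∑ i ∈ Finset.range n, f i :=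
  Fin.sum_univ_eq_sum_range (fun i : ℕ => f (i : ℤ)) n

lemma proj_ineq {r n : ℕ} {V : ℝ} (est : (Fin n → ℝ) → Fin n → ℝ)
    (hest : IsProjOn est (Kset r n V)) (θ : Fin n → ℝ) (hθ : θ ∈ Kset r n V)
    (θs ξ : Fin n → ℝ) :
    sqnorm (est (θs + ξ) - θs) ≤ sqnorm (θs - θ) +
      (2 * ∑ i, ξ i * (est (θs + ξ) - θ) i - ∑ i, (est (θs + ξ) - θ) i ^ 2) := by
  set y := θs + ξ with hy
  set e := est y with he
  obtain ⟨hK, hmin⟩ := hest y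
  rw [← he] at hK hmin
  set B := ∑ i, (y i - e i) * (θ i - e i) with hB
  set A := ∑ i, (θ i - e i) ^ 2 with hA
  have key : ∀ t : ℝ, 0 ≤ t → t ≤ 1 → 0 ≤ - 2 * t * B + t ^ 2 * A := by
    intro t ht ht1
    have hmem : e + t • (θ - e) ∈ Kset r n V := by
      simp only [Kset, Set.mem_ofPred_eq, Dl1] at hK hθ ⊢
      calc ∑ s ∈ Finset.range (n - r), |DD r (e + t • (θ - e)) s|
          ≤ ∑ s ∈ Finset.range (n - r), ((1 - t) * |DD r e s| + t * |DD r θ s|) := by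
            apply Finset.sum_le_sum; intro s _
            rw [DD_add_smul, DD_sub]
            have : DD r e s + t * (DD r θ s - DD r e s) = (1 - t) * DD r e s + t * DD r θ s := by
              ring
            rw [this]
            refine (abs_add_le _ _).trans ?_
            rw [abs_mul, abs_mul, abs_of_nonneg ht, abs_of_nonneg (by linarith : 0 ≤ 1 - t)]
        _ = (1 - t) * ∑ s ∈ Finset.range (n - r), |DD r e s| +
            t * ∑ s ∈ Finset.range (n - r), |DD r θ s| := by
            rw [Finset.sum_add_distrib, Finset.mul_sum, Finset.mul_sum]
        _ ≤ (1 - t) * (V * (n : ℝ) ^ (1 - (r : ℤ))) + t * (V * (n : ℝ) ^ (1 - (r : ℤ))) := by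
            gcongr
        _ = _ := by ring
    have h := hmin _ hmem
    have e1 : sqnorm (y - (e + t • (θ - e))) = sqnorm (y - e) + (- 2 * t * B + t ^ 2 * A) := by
      simp only [sqnorm, hA, hB, Finset.mul_sum, ← Finset.sum_add_distrib]
      apply Finset.sum_congr rfl; intro i _
      simp only [Pi.sub_apply, Pi.add_apply, Pi.smul_apply, smul_eq_mul]; ring
    linarith
  have hBneg : B ≤ 0 := by
    by_contra hpos
    push Not at hpos
    have hA0 : 0 ≤ A := Finset.sum_nonneg fun i _ => sq_nonneg _
    have h := key (B / (A + B)) (by positivity) (by rw [div_le_one (by positivity)]; linarith)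
    have hAB : 0 < A + B := by positivity
    have : -2 * (B / (A + B)) * B + (B / (A + B)) ^ 2 * A
        = - (B ^ 2 * (A + 2 * B)) / (A + B) ^ 2 := by
      field_simp; ring
    rw [this] at h
    have h2 : - (B ^ 2 * (A + 2 * B)) / (A + B) ^ 2 < 0 := by
      apply div_neg_of_neg_of_pos
      · have : 0 < B ^ 2 * (A + 2 * B) := by positivity
        linarith
      · positivity
    linarith
  have : sqnorm (e - θs) = sqnorm (θs - θ) +
      (2 * ∑ i, ξ i * (e - θ) i - ∑ i, (e - θ) i ^ 2) + 2 * B := by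
    simp only [sqnorm, hB, Finset.mul_sum, ← Finset.sum_add_distrib, ← Finset.sum_sub_distrib]
    apply Finset.sum_congr rfl; intro i _
    simp only [hy, Pi.sub_apply, Pi.add_apply]; ring
  linarith

lemma cone_ineq {r n : ℕ} (θ e : Fin n → ℝ) (h : Dl1 r e ≤ Dl1 r θ) (y : ℕ → ℝ) (Λ : ℝ)
    (hΛ : 0 ≤ Λ) (hy : ∀ t < n - r, |y t| ≤ Λ)
    (hs : ∀ t < n - r, y t * DD r θ t = Λ * |DD r θ t|) :
    ∑ t ∈ Finset.range (n - r), DD r (e - θ) t * y t ≤ 0 := by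
  have : ∑ t ∈ Finset.range (n - r), DD r (e - θ) t * y t ≤
      ∑ t ∈ Finset.range (n - r), (Λ * |DD r e t| - Λ * |DD r θ t|) := by
    apply Finset.sum_le_sum; intro t ht
    rw [Finset.mem_range] at ht
    rw [DD_sub, sub_mul, mul_comm (DD r θ t), hs t ht]
    have : DD r e t * y t ≤ Λ * |DD r e t| := by
      calc DD r e t * y t ≤ |DD r e t * y t| := le_abs_self _
        _ = |y t| * |DD r e t| := by rw [abs_mul, mul_comm]
        _ ≤ _ := mul_le_mul_of_nonneg_right (hy t ht) (abs_nonneg _)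
    linarith
  rw [Finset.sum_sub_distrib, ← Finset.mul_sum, ← Finset.mul_sum] at this
  have := mul_le_mul_of_nonneg_left h hΛ
  simp only [Dl1] at this
  linarith

lemma pathwise {r n : ℕ} (hrn : r ≤ n) (θ e ξ : Fin n → ℝ) (h : Dl1 r e ≤ Dl1 r θ)
    (p w q : ℤ → ℝ) (Λ : ℝ) (hΛ : 0 ≤ Λ)
    (hx : ∀ i : Fin n, ξ i = p i.1 + (-1) ^ r * (bdL ^ r) w i.1)
    (w0 : ∀ t < 0, w t = 0) (w1 : ∀ t, ((n - r : ℕ) : ℤ) ≤ t → w t = 0)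
    (q0 : ∀ t < 0, q t = 0) (q1 : ∀ t, ((n - r : ℕ) : ℤ) ≤ t → q t = 0)
    (hy : ∀ t : ℕ, t < n - r → |Λ * q t + w t| ≤ Λ)
    (hs : ∀ t : ℕ, t < n - r → (Λ * q t + w t) * DD r θ t = Λ * |DD r θ t|) :
    2 * ∑ i, ξ i * (e - θ) i - ∑ i, (e - θ) i ^ 2 ≤
      2 * ∑ i ∈ Finset.range n, p i ^ 2 + 2 * Λ ^ 2 * ∑ i ∈ Finset.range n, ((bdL ^ r) q i) ^ 2 := by
  have hc := cone_ineq θ e h (fun t => Λ * q t + w t) Λ hΛ hy hs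
  set u := extZ (e - θ) with hu
  simp only [← fd_extZ] at hc
  rw [← hu] at hc
  have hz := sbp r (n - r) u (Λ • q + w)
    (fun t ht => by simp [q0 t ht, w0 t ht]) (fun t ht => by simp [q1 t ht, w1 t ht])
  simp only [Pi.add_apply, Pi.smul_apply, smul_eq_mul, map_add, map_smul] at hz
  rw [hz, Nat.sub_add_cancel hrn] at hc
  have e1 : ∑ i, ξ i * (e - θ) i = ∑ i ∈ Finset.range n, (p i * u i + (-1) ^ r * (u i * (bdL ^ r) w i)) := by
    rw [← sum_fin_ext (fun i => p i * u i + (-1) ^ r * (u i * (bdL ^ r) w i))]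
    apply Finset.sum_congr rfl; intro i _
    rw [hx i, hu, extZ_fin]; ring
  have e2 : ∑ i, (e - θ) i ^ 2 = ∑ i ∈ Finset.range n, u i ^ 2 := by
    rw [← sum_fin_ext (fun i => u i ^ 2)]
    apply Finset.sum_congr rfl; intro i _
    rw [hu, extZ_fin]
  rw [e1, e2]
  have e3 : (-1) ^ r * ∑ i ∈ Finset.range n, u i * (Λ * (bdL ^ r) q i + (bdL ^ r) w i) =
    ∑ i ∈ Finset.range n, ((-1) ^ r * Λ * (u i * (bdL ^ r) q i) + (-1) ^ r * (u i * (bdL ^ r) w i)) := by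
    rw [Finset.mul_sum]; apply Finset.sum_congr rfl; intro i _; ring
  rw [e3] at hc
  have hsq : ((-1 : ℝ) ^ r) ^ 2 = 1 := by rw [← pow_mul, mul_comm, pow_mul]; simp
  have : ∑ i ∈ Finset.range n, (2 * (p i * u i + (-1) ^ r * (u i * (bdL ^ r) w i)) - u i ^ 2)
     ≤ ∑ i ∈ Finset.range n, ((2 * p i ^ 2 + 2 * Λ ^ 2 * (bdL ^ r) q i ^ 2) +
        2 * ((-1) ^ r * Λ * (u i * (bdL ^ r) q i) + (-1) ^ r * (u i * (bdL ^ r) w i))) := by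
    apply Finset.sum_le_sum; intro i _
    set a := p i
    set b := (-1) ^ r * Λ * (bdL ^ r) q i with hb
    have hb2 : b ^ 2 = Λ ^ 2 * (bdL ^ r) q i ^ 2 := by
      rw [hb, mul_pow, mul_pow, hsq]; ring
    have : (-1) ^ r * Λ * (u i * (bdL ^ r) q i) = u i * b := by rw [hb]; ring
    rw [this]
    nlinarith [sq_nonneg (u i - a + b), sq_nonneg (a + b)]
  simp only [Finset.sum_sub_distrib, ← Finset.mul_sum, Finset.sum_add_distrib] at this hc ⊢
  linarith

lemma energy_overlap {ι : Type*} [DecidableEq ι] (s : Finset ι) (g : ι → ℤ → ℝ)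
    (J : ι → Finset ℤ) (B : ι → ℝ) (κ : ℕ)
    (hz : ∀ c ∈ s, ∀ t, t ∉ J c → g c t = 0) (hB : ∀ c ∈ s, ∀ t, |g c t| ≤ B c)
    (hκ : ∀ t : ℤ, (s.filter (fun c => t ∈ J c)).card ≤ κ) (n : ℕ) :
    ∑ t ∈ Finset.range n, (∑ c ∈ s, g c t) ^ 2 ≤ κ * ∑ c ∈ s, (J c).card * B c ^ 2 := by
  have h1 : ∀ t : ℕ, (∑ c ∈ s, g c t) ^ 2 ≤ κ * ∑ c ∈ s, g c t ^ 2 := by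
    intro t
    have e : ∑ c ∈ s, g c t = ∑ c ∈ s.filter (fun c => (t : ℤ) ∈ J c), g c t := by
      rw [Finset.sum_filter]; apply Finset.sum_congr rfl; intro c hc
      split_ifs with h
      · rfl
      · exact hz c hc _ h
    rw [e]
    calc _ ≤ ((s.filter (fun c => (t : ℤ) ∈ J c)).card : ℝ) *
          ∑ c ∈ s.filter (fun c => (t : ℤ) ∈ J c), g c t ^ 2 := sq_sum_le_card_mul_sum_sq
      _ ≤ κ * ∑ c ∈ s, g c t ^ 2 := by
          apply mul_le_mul
          · exact_mod_cast hκ t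
          · exact Finset.sum_le_sum_of_subset_of_nonneg (Finset.filter_subset _ _)
              (fun _ _ _ => sq_nonneg _)
          · exact Finset.sum_nonneg fun _ _ => sq_nonneg _
          · positivity
  calc _ ≤ ∑ t ∈ Finset.range n, κ * ∑ c ∈ s, g c t ^ 2 := Finset.sum_le_sum fun t _ => h1 t
    _ = κ * ∑ c ∈ s, ∑ t ∈ Finset.range n, g c t ^ 2 := by
        rw [← Finset.mul_sum, Finset.sum_comm]
    _ ≤ _ := by
        apply mul_le_mul_of_nonneg_left _ (by positivity)
        apply Finset.sum_le_sum; intro c hc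
        have e2 : ∑ t ∈ Finset.range n, g c t ^ 2 = ∑ t ∈ (Finset.range n).map Nat.castEmbedding,
            g c t ^ 2 := by
          rw [Finset.sum_map]; rfl
        rw [e2]
        calc ∑ t ∈ (Finset.range n).map Nat.castEmbedding, g c t ^ 2
            = ∑ t ∈ ((Finset.range n).map (Nat.castEmbedding (R := ℤ))).filter (fun t => t ∈ J c), g c t ^ 2 := by
              rw [Finset.sum_filter]; apply Finset.sum_congr rfl; intro t _
              split_ifs with h
              · rfl
              · rw [hz c hc _ h]; simp
          _ ≤ ∑ t ∈ J c, g c t ^ 2 := by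
              apply Finset.sum_le_sum_of_subset_of_nonneg
              · intro t ht; exact (Finset.mem_filter.1 ht).2
              · intros; exact sq_nonneg _
          _ ≤ ∑ t ∈ J c, B c ^ 2 := by
              apply Finset.sum_le_sum; intro t _
              exact sq_le_sq' (by linarith [neg_abs_le (g c t), hB c hc t])
                ((le_abs_self _).trans (hB c hc t))
          _ = _ := by rw [Finset.sum_const, nsmul_eq_mul]

/-- The skeleton. -/
def trn (τ : ℕ → ℤ) (lam : ℕ → ℝ) (i : ℕ) : ℤ → ℝ := fun t => chi ((1 / lam i) * t + (- τ i / lam i))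

def skel (k : ℕ) (τ : ℕ → ℤ) (lam : ℕ → ℝ) (v : ℕ → ℝ) : ℤ → ℝ :=
  ∑ i ∈ Finset.range (k + 1), (v (i + 1) - v i) • trn τ lam i

section
variable {k : ℕ} {τ : ℕ → ℤ} {lam : ℕ → ℝ} {v : ℕ → ℝ}

lemma trn_eq (i : ℕ) (t : ℤ) : trn τ lam i t = chi (((t : ℝ) - τ i) / lam i) := by
  unfold trn; congr 1; ring

lemma trn_zero (hl : ∀ i, 0 < lam i) {i : ℕ} {t : ℤ} (h : t ≤ τ i) : trn τ lam i t = 0 := by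
  rw [trn_eq]; apply Real.smoothTransition.zero_of_nonpos
  apply div_nonpos_of_nonpos_of_nonneg _ (hl i).le
  have : (t : ℝ) ≤ τ i := by exact_mod_cast h
  linarith

lemma trn_one (hl : ∀ i, 0 < lam i) {i : ℕ} {t : ℤ} (h : (τ i : ℝ) + lam i ≤ t) :
    trn τ lam i t = 1 := by
  rw [trn_eq]; apply Real.smoothTransition.one_of_one_le
  rw [le_div_iff₀ (hl i)]; linarith

lemma tau_growth (hτ : ∀ i ≤ k, τ i < τ (i + 1)) {i j : ℕ} (hij : i ≤ j) (hj : j ≤ k + 1) :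
    τ i + (j - i : ℕ) ≤ τ j := by
  induction j, hij using Nat.le_induction with
  | base => simp
  | succ j hij ih =>
    have h1 := ih (by omega)
    have h2 := hτ j (by omega)
    have : ((j + 1 - i : ℕ) : ℤ) = (j - i : ℕ) + 1 := by
      rw [Nat.sub_add_comm hij]; simp
    rw [this]; linarith

lemma tau_mono (hτ : ∀ i ≤ k, τ i < τ (i + 1)) {i j : ℕ} (hij : i ≤ j) (hj : j ≤ k + 1) :
    τ i ≤ τ j := by
  have := tau_growth hτ hij hj
  linarith [Int.natCast_nonneg (j - i)]

lemma tau_seg (hτ : ∀ i ≤ k, τ i < τ (i + 1)) (t : ℤ) (h0 : τ 0 ≤ t) (h1 : t < τ (k + 1)) :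
    ∃ j ≤ k, τ j ≤ t ∧ t < τ (j + 1) := by
  induction k with
  | zero => exact ⟨0, le_rfl, h0, h1⟩
  | succ k ih =>
    by_cases h : t < τ (k + 1)
    · obtain ⟨j, hj, h⟩ := ih (fun i hi => hτ i (by omega)) h
      exact ⟨j, by omega, h⟩
    · exact ⟨k + 1, le_rfl, not_lt.1 h, h1⟩

lemma skel_apply (t : ℤ) : skel k τ lam v t =
    ∑ i ∈ Finset.range (k + 1), (v (i + 1) - v i) * trn τ lam i t := by
  simp [skel, Finset.sum_apply]

lemma skel_seg (hτ : ∀ i ≤ k, τ i < τ (i + 1)) (hl : ∀ i, 0 < lam i)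
    (hlL : ∀ i ≤ k, (τ i : ℝ) + lam i ≤ τ (i + 1)) (hv0 : v 0 = 0) {j : ℕ} (hj : j ≤ k) {t : ℤ}
    (h0 : τ j ≤ t) (h1 : t ≤ τ (j + 1)) :
    skel k τ lam v t = v j + (v (j + 1) - v j) * trn τ lam j t := by
  rw [skel_apply, Finset.range_eq_Ico, ← Finset.sum_Ico_consecutive _ (Nat.zero_le j) (by omega : j ≤ k + 1),
    Finset.sum_eq_sum_Ico_succ_bot (by omega : j < k + 1)]
  have e1 : ∑ i ∈ Finset.Ico 0 j, (v (i + 1) - v i) * trn τ lam i t = v j := by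
    rw [← Finset.range_eq_Ico]
    have : ∑ i ∈ Finset.range j, (v (i + 1) - v i) = v j - v 0 := Finset.sum_range_sub v j
    rw [hv0, sub_zero] at this
    rw [← this]
    apply Finset.sum_congr rfl; intro i hi
    rw [Finset.mem_range] at hi
    rw [trn_one hl, mul_one]
    refine (hlL i (by omega)).trans ?_
    exact_mod_cast (tau_mono hτ (by omega : i + 1 ≤ j) (by omega)).trans h0
  have e2 : ∑ i ∈ Finset.Ico (j + 1) (k + 1), (v (i + 1) - v i) * trn τ lam i t = 0 := by
    apply Finset.sum_eq_zero; intro i hi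
    rw [Finset.mem_Ico] at hi
    rw [trn_zero hl, mul_zero]
    exact h1.trans (tau_mono hτ hi.1 (by omega))
  rw [e1, e2]; ring

lemma skel_left (hτ : ∀ i ≤ k, τ i < τ (i + 1)) (hl : ∀ i, 0 < lam i) {t : ℤ} (h : t ≤ τ 0) :
    skel k τ lam v t = 0 := by
  rw [skel_apply]
  apply Finset.sum_eq_zero; intro i hi
  rw [Finset.mem_range] at hi
  rw [trn_zero hl, mul_zero]
  exact h.trans (tau_mono hτ (Nat.zero_le i) (by omega))

lemma skel_right (hτ : ∀ i ≤ k, τ i < τ (i + 1)) (hl : ∀ i, 0 < lam i)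
    (hlL : ∀ i ≤ k, (τ i : ℝ) + lam i ≤ τ (i + 1)) (hv0 : v 0 = 0) (hv1 : v (k + 1) = 0) {t : ℤ}
    (h : τ (k + 1) ≤ t) : skel k τ lam v t = 0 := by
  rw [skel_apply]
  have : ∑ i ∈ Finset.range (k + 1), (v (i + 1) - v i) = v (k + 1) - v 0 := Finset.sum_range_sub v _
  rw [hv0, hv1, sub_zero] at this
  rw [← this]
  apply Finset.sum_congr rfl; intro i hi
  rw [Finset.mem_range] at hi
  rw [trn_one hl, mul_one]
  refine (hlL i (by omega)).trans ?_
  exact_mod_cast (tau_mono hτ (by omega : i + 1 ≤ k + 1) (by omega)).trans h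

lemma trn_nonneg (i : ℕ) (t : ℤ) : 0 ≤ trn τ lam i t := Real.smoothTransition.nonneg _
lemma trn_le_one (i : ℕ) (t : ℤ) : trn τ lam i t ≤ 1 := Real.smoothTransition.le_one _

lemma skel_bound (hτ : ∀ i ≤ k, τ i < τ (i + 1)) (hl : ∀ i, 0 < lam i)
    (hlL : ∀ i ≤ k, (τ i : ℝ) + lam i ≤ τ (i + 1)) (hv0 : v 0 = 0) (hv1 : v (k + 1) = 0)
    (hv : ∀ i, |v i| ≤ 1) (t : ℤ) : |skel k τ lam v t| ≤ 1 := by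
  by_cases h0 : t ≤ τ 0
  · rw [skel_left hτ hl h0]; simp
  by_cases h1 : τ (k + 1) ≤ t
  · rw [skel_right hτ hl hlL hv0 hv1 h1]; simp
  obtain ⟨j, hj, ha, hb⟩ := tau_seg hτ t (by omega) (by omega)
  rw [skel_seg hτ hl hlL hv0 hj ha hb.le]
  have h1 := trn_nonneg (τ := τ) (lam := lam) j t
  have h2 := trn_le_one (τ := τ) (lam := lam) j t
  have h3 := abs_le.1 (hv j)
  have h4 := abs_le.1 (hv (j + 1))
  rw [abs_le]; constructor <;> nlinarith

lemma skel_knot (hτ : ∀ i ≤ k, τ i < τ (i + 1)) (hl : ∀ i, 0 < lam i)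
    (hlL : ∀ i ≤ k, (τ i : ℝ) + lam i ≤ τ (i + 1)) (hv0 : v 0 = 0) {j : ℕ} (hj : j ≤ k) :
    skel k τ lam v (τ j) = v j := by
  rw [skel_seg hτ hl hlL hv0 hj le_rfl (hτ j hj).le, trn_zero hl le_rfl]; ring

def crossing (τ : ℕ → ℤ) (lam : ℕ → ℝ) (i : ℕ) : ℤ := τ i + ⌊lam i / 2⌋

lemma skel_sign (hτ : ∀ i ≤ k, τ i < τ (i + 1)) (hl : ∀ i, 0 < lam i)
    (hlL : ∀ i ≤ k, (τ i : ℝ) + lam i ≤ τ (i + 1)) (hv0 : v 0 = 0) (hv1 : v (k + 1) = 0)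
    (hv : ∀ i, v i = 0 ∨ v i = 1 ∨ v i = -1) (A B : ℤ)
    (hN : ∀ i ≤ k + 1, ¬ (A ≤ τ i ∧ τ i ≤ B)) (hC : ∀ i ≤ k, ¬ (A ≤ crossing τ lam i ∧ crossing τ lam i ≤ B)) :
    (∀ t, A ≤ t → t ≤ B → 0 ≤ skel k τ lam v t) ∨ (∀ t, A ≤ t → t ≤ B → skel k τ lam v t ≤ 0) := by
  by_cases hAB : A ≤ B
  swap
  · left; intro t h1 h2; omega
  by_cases h0 : A ≤ τ 0
  · left; intro t ht1 ht2
    have := hN 0 (by omega)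
    rw [skel_left hτ hl (by omega)]
  by_cases h1 : τ (k + 1) ≤ A
  · left; intro t ht1 ht2
    rw [skel_right hτ hl hlL hv0 hv1 (by omega)]
  obtain ⟨j, hj, ha, hb⟩ := tau_seg hτ A (by omega) (by omega)
  have hBj : B < τ (j + 1) := by
    have := hN (j + 1) (by omega); omega
  have hseg : ∀ t, A ≤ t → t ≤ B → skel k τ lam v t = v j + (v (j + 1) - v j) * trn τ lam j t :=
    fun t h1 h2 => skel_seg hτ hl hlL hv0 hj (by omega) (by omega)
  have hcr : B < crossing τ lam j ∨ crossing τ lam j < A := by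
    have := hC j hj; omega
  have hlow : B < crossing τ lam j → ∀ t, A ≤ t → t ≤ B → trn τ lam j t ≤ 1 / 2 := by
    intro hc t h1 h2
    rw [trn_eq]; apply chi_half_le
    rw [div_le_iff₀ (hl j)]
    have h3 : t ≤ τ j + ⌊lam j / 2⌋ := by unfold crossing at hc; omega
    have h4 : (t : ℝ) ≤ τ j + ⌊lam j / 2⌋ := by exact_mod_cast h3
    linarith [Int.floor_le (lam j / 2)]
  have hhigh : crossing τ lam j < A → ∀ t, A ≤ t → t ≤ B → 1 / 2 ≤ trn τ lam j t := by
    intro hc t h1 h2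
    rw [trn_eq]; apply chi_half_ge
    rw [le_div_iff₀ (hl j)]
    have h3 : τ j + ⌊lam j / 2⌋ + 1 ≤ t := by unfold crossing at hc; omega
    have h4 : (τ j : ℝ) + ⌊lam j / 2⌋ + 1 ≤ t := by exact_mod_cast h3
    linarith [Int.lt_floor_add_one (lam j / 2)]
  have hn := trn_nonneg (τ := τ) (lam := lam) j
  have ho := trn_le_one (τ := τ) (lam := lam) j
  rcases hv j with e | e | e <;> rcases hv (j + 1) with e' | e' | e' <;> rw [e, e'] at hseg
  · left; intro t h1 h2; rw [hseg t h1 h2]; linarith [hn t, ho t]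
  · left; intro t h1 h2; rw [hseg t h1 h2]; linarith [hn t, ho t]
  · right; intro t h1 h2; rw [hseg t h1 h2]; linarith [hn t, ho t]
  · left; intro t h1 h2; rw [hseg t h1 h2]; linarith [hn t, ho t]
  · left; intro t h1 h2; rw [hseg t h1 h2]; linarith [hn t, ho t]
  · rcases hcr with hc | hc
    · left; intro t h1 h2; rw [hseg t h1 h2]; linarith [hlow hc t h1 h2]
    · right; intro t h1 h2; rw [hseg t h1 h2]; linarith [hhigh hc t h1 h2]
  · right; intro t h1 h2; rw [hseg t h1 h2]; linarith [hn t, ho t]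
  · rcases hcr with hc | hc
    · right; intro t h1 h2; rw [hseg t h1 h2]; linarith [hlow hc t h1 h2]
    · left; intro t h1 h2; rw [hseg t h1 h2]; linarith [hhigh hc t h1 h2]
  · right; intro t h1 h2; rw [hseg t h1 h2]; linarith [hn t, ho t]

end

lemma zpow_aux (r : ℕ) (x : ℝ) (hx : 0 < x) : x * ((1 / x) ^ r) ^ 2 = x ^ (1 - 2 * (r : ℤ)) := by
  rw [zpow_sub₀ hx.ne', zpow_one, one_div, inv_pow, inv_pow, ← pow_mul, div_eq_mul_inv]
  congr 2
  rw [mul_comm, ← zpow_natCast]; push_cast; rfl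

lemma skel_energy (r : ℕ) (hr : 1 ≤ r) : ∃ C : ℝ, 0 < C ∧ ∀ (k : ℕ) (τ : ℕ → ℤ) (lam v : ℕ → ℝ),
    (∀ i ≤ k, τ i < τ (i + 1)) → (∀ i, 1 ≤ lam i) →
    (∀ i ≤ k, (τ i : ℝ) + lam i ≤ τ (i + 1)) → (∀ i, |v i| ≤ 1) → ∀ n : ℕ,
    ∑ t ∈ Finset.range n, ((bdL ^ r) (skel k τ lam v) t) ^ 2 ≤
      C * ∑ i ∈ Finset.range (k + 1), if v i ≠ v (i + 1) then lam i ^ (1 - 2 * (r : ℤ)) else 0 := by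
  obtain ⟨A, hA, hAb⟩ := chi_deriv_bound r
  refine ⟨(r + 3) * (4 * (r + 3) * A ^ 2), by positivity, ?_⟩
  intro k τ lam v hτ hl1 hlL hv n
  have hl : ∀ i, 0 < lam i := fun i => by linarith [hl1 i]
  have hsk : ∀ t : ℤ, (bdL ^ r) (skel k τ lam v) t =
      ∑ i ∈ Finset.range (k + 1), ((v (i + 1) - v i) * (bdL ^ r) (trn τ lam i) t) := by
    intro t; rw [skel, map_sum, Finset.sum_apply]
    apply Finset.sum_congr rfl; intro i _; rw [map_smul]; rfl
  simp_rw [hsk]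
  have := energy_overlap (Finset.range (k + 1))
    (fun i t => (v (i + 1) - v i) * (bdL ^ r) (trn τ lam i) t)
    (fun i => Finset.Icc (τ i) (τ i + ⌊lam i⌋ + r + 1))
    (fun i => if v i ≠ v (i + 1) then 2 * ((1 / lam i) ^ r * A) else 0) (r + 3)
    (by
      intro i hi t ht
      rw [Finset.mem_Icc, not_and_or, not_le, not_le] at ht
      rcases ht with ht | ht
      · rw [bd_zero_of_const r hr _ t 0, mul_zero]
        intro s _ hs; exact trn_zero hl (by omega)
      · rw [bd_zero_of_const r hr _ t 1, mul_zero]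
        intro s hs _; apply trn_one hl
        have h3 : τ i + ⌊lam i⌋ + 1 ≤ s := by omega
        have h4 : (τ i : ℝ) + ⌊lam i⌋ + 1 ≤ s := by exact_mod_cast h3
        linarith [Int.lt_floor_add_one (lam i)])
    (by
      intro i hi t
      split_ifs with h
      · rw [abs_mul]
        apply mul_le_mul
        · have h3 := abs_le.1 (hv i)
          have h4 := abs_le.1 (hv (i + 1))
          rw [abs_le]; constructor <;> linarith
        · exact bd_sample_bound r _ _ A (by have := hl i; positivity) chi
            Real.smoothTransition.contDiff hAb t
        · exact abs_nonneg _
        · norm_num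
      · push Not at h; rw [h]; simp)
    (by
      intro t
      set S := (Finset.range (k + 1)).filter
        (fun c => t ∈ Finset.Icc (τ c) (τ c + ⌊lam c⌋ + r + 1)) with hS
      by_cases hne : S.Nonempty
      · have hsub : S ⊆ Finset.Icc (S.min' hne) (S.min' hne + (r + 2)) := by
          intro i hi
          have hmin := S.min'_mem hne
          have hle := S.min'_le i hi
          set i0 := S.min' hne
          rw [hS, Finset.mem_filter, Finset.mem_range, Finset.mem_Icc] at hi hmin
          rw [Finset.mem_Icc]
          refine ⟨hle, ?_⟩
          by_contra hcon
          have hg := tau_growth hτ (i := i0 + 1) (j := i) (by omega) (by omega)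
          have h1 := hlL i0 (by omega)
          have h2 : τ i0 + ⌊lam i0⌋ ≤ τ (i0 + 1) := by
            have := Int.floor_le (lam i0)
            have : (τ i0 : ℝ) + ⌊lam i0⌋ ≤ τ (i0 + 1) := by linarith
            exact_mod_cast this
          omega
        calc S.card ≤ _ := Finset.card_le_card hsub
          _ = r + 3 := by rw [Nat.card_Icc]; omega
      · rw [Finset.not_nonempty_iff_eq_empty] at hne
        rw [hne]; simp) n
  refine this.trans ?_
  push_cast
  rw [mul_assoc ((r:ℝ) + 3)]
  apply mul_le_mul_of_nonneg_left _ (by positivity)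
  rw [Finset.mul_sum]
  apply Finset.sum_le_sum; intro i hi
  split_ifs with h
  · rw [Int.card_Icc]
    have hfl : 0 ≤ ⌊lam i⌋ := Int.floor_nonneg.2 (hl i).le
    have hc : (((τ i + ⌊lam i⌋ + r + 1 + 1 - τ i).toNat : ℕ) : ℝ) ≤ (r + 3) * lam i := by
      have : (((τ i + ⌊lam i⌋ + r + 1 + 1 - τ i).toNat : ℕ) : ℤ) = ⌊lam i⌋ + r + 2 := by
        rw [Int.toNat_of_nonneg] <;> omega
      have : (((τ i + ⌊lam i⌋ + r + 1 + 1 - τ i).toNat : ℕ) : ℝ) = ⌊lam i⌋ + r + 2 := by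
        exact_mod_cast this
      rw [this]
      nlinarith [Int.floor_le (lam i), hl1 i, (Nat.cast_nonneg r : (0:ℝ) ≤ r)]
    calc _ ≤ ((r + 3) * lam i) * (2 * ((1 / lam i) ^ r * A)) ^ 2 :=
          mul_le_mul_of_nonneg_right hc (sq_nonneg _)
      _ = _ := by rw [← zpow_aux r (lam i) (hl i)]; ring
  · simp

/-- A dyadic cell whose enlargement avoids the exceptional set `N`. -/
def Adm (N : Finset ℤ) (l : ℕ) (a : ℤ) : Prop :=
  ∀ ν ∈ N, ¬ ((a - 2) * 2 ^ l ≤ ν ∧ ν ≤ (a + 4) * 2 ^ l)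

open Classical in
def cells (N : Finset ℤ) (M n : ℕ) : Finset (ℕ × ℤ) :=
  ((Finset.range (M + 1)) ×ˢ (Finset.Ico (0 : ℤ) n)).filter
    (fun c => c.2 * 2 ^ c.1 < n ∧ (c.1 = 0 ∨ Adm N c.1 c.2) ∧ (c.1 = M ∨ ¬ Adm N (c.1 + 1) (c.2 / 2)))

lemma mem_cells {N : Finset ℤ} {M n : ℕ} {c : ℕ × ℤ} : c ∈ cells N M n ↔
    c.1 ≤ M ∧ 0 ≤ c.2 ∧ c.2 * 2 ^ c.1 < n ∧ (c.1 = 0 ∨ Adm N c.1 c.2) ∧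
      (c.1 = M ∨ ¬ Adm N (c.1 + 1) (c.2 / 2)) := by
  classical
  unfold cells
  rw [Finset.mem_filter, Finset.mem_product, Finset.mem_range, Finset.mem_Ico]
  constructor
  · rintro ⟨⟨h1, h2, h3⟩, h4, h5, h6⟩
    exact ⟨by omega, h2, h4, h5, h6⟩
  · rintro ⟨h1, h2, h4, h5, h6⟩
    refine ⟨⟨by omega, h2, ?_⟩, h4, h5, h6⟩
    have : (1 : ℤ) ≤ 2 ^ c.1 := one_le_pow₀ (by norm_num)
    nlinarith

lemma adm_child {N : Finset ℤ} {l : ℕ} {a : ℤ} (h : Adm N (l + 1) (a / 2)) : Adm N l a := by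
  intro ν hν ⟨h1, h2⟩
  apply h ν hν
  have hp : (0 : ℤ) < 2 ^ l := by positivity
  have e1 : a - 1 ≤ 2 * (a / 2) := by omega
  have e2 : 2 * (a / 2) ≤ a := by omega
  rw [pow_succ]
  constructor <;> nlinarith

lemma div_pow_succ (i : ℤ) (l : ℕ) : i / 2 ^ (l + 1) = i / 2 ^ l / 2 := by
  rw [pow_succ, Int.ediv_ediv_of_nonneg (by positivity)]

lemma adm_down {N : Finset ℤ} {i : ℤ} {l l' : ℕ} (hl : l ≤ l') (h : Adm N l' (i / 2 ^ l')) :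
    Adm N l (i / 2 ^ l) := by
  induction l', hl using Nat.le_induction with
  | base => exact h
  | succ l' hl ih =>
    apply ih; apply adm_child; rwa [← div_pow_succ]

lemma exists_cell (N : Finset ℤ) (M n : ℕ) (i : ℕ) (hi : i < n) :
    ∃ l : ℕ, (l, (i : ℤ) / 2 ^ l) ∈ cells N M n := by
  classical
  let P : ℕ → Prop := fun l => l = 0 ∨ Adm N l ((i : ℤ) / 2 ^ l)
  let l := Nat.findGreatest P M
  have hl : P l := Nat.findGreatest_spec (P := P) (Nat.zero_le M) (Or.inl rfl)
  have hM : l ≤ M := Nat.findGreatest_le M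
  refine ⟨l, mem_cells.2 ⟨hM, by positivity, ?_, hl, ?_⟩⟩
  · have := Int.ediv_mul_le (i : ℤ) (b := 2 ^ l) (by positivity)
    simp only; omega
  · by_cases h : l = M
    · exact Or.inl h
    · right
      have := Nat.findGreatest_is_greatest (P := P) (n := M) (k := l + 1) (Nat.lt_succ_self _) (by omega)
      intro h'
      apply this; right
      rw [div_pow_succ]; exact h'

lemma unique_cell {N : Finset ℤ} {M n : ℕ} {i : ℤ} {l l' : ℕ} (h : (l, i / 2 ^ l) ∈ cells N M n)
    (h' : (l', i / 2 ^ l') ∈ cells N M n) : l = l' := by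
  have key : ∀ l l' : ℕ, (l, i / 2 ^ l) ∈ cells N M n → (l', i / 2 ^ l') ∈ cells N M n → ¬ l < l' := by
    intro l l' h h' hlt
    rw [mem_cells] at h h'
    obtain ⟨h1, h2, h3, h4, h5⟩ := h
    obtain ⟨h1', h2', h3', h4', h5'⟩ := h'
    simp only at *
    have a1 : Adm N l' (i / 2 ^ l') := by rcases h4' with h | h; omega; exact h
    have a2 := adm_down (N := N) (i := i) (show l + 1 ≤ l' by omega) a1
    rw [div_pow_succ] at a2
    rcases h5 with h | h
    · omega
    · exact h a2
  have := key l l' h h'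
  have := key l' l h' h
  omega

lemma mem_cell_iff {i a : ℤ} {l : ℕ} : (a * 2 ^ l ≤ i ∧ i < (a + 1) * 2 ^ l) ↔ i / 2 ^ l = a := by
  have hp : (0 : ℤ) < 2 ^ l := by positivity
  constructor
  · rintro ⟨h1, h2⟩
    apply le_antisymm
    · have := (Int.ediv_lt_iff_lt_mul hp).2 h2; omega
    · exact (Int.le_ediv_iff_mul_le hp).2 h1
  · rintro rfl
    refine ⟨Int.ediv_mul_le _ hp.ne', ?_⟩
    exact Int.lt_ediv_add_one_mul_self _ hp

/-- every point of `[0,n)` is in exactly one cell -/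
lemma cell_unique_mem (N : Finset ℤ) (M n : ℕ) (i : ℕ) (hi : i < n) :
    ∃ c ∈ cells N M n, (c.2 * 2 ^ c.1 ≤ (i : ℤ) ∧ (i : ℤ) < (c.2 + 1) * 2 ^ c.1) ∧
      ∀ c' ∈ cells N M n, c' ≠ c → ¬ (c'.2 * 2 ^ c'.1 ≤ (i : ℤ) ∧ (i : ℤ) < (c'.2 + 1) * 2 ^ c'.1) := by
  obtain ⟨l, hl⟩ := exists_cell N M n i hi
  refine ⟨_, hl, mem_cell_iff.2 rfl, ?_⟩
  rintro ⟨l', a'⟩ hc' hne hm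
  have := mem_cell_iff.1 hm
  simp only at this
  subst this
  have := unique_cell hl hc'
  subst this
  exact hne rfl

lemma cells_card (N : Finset ℤ) (M n : ℕ) :
    ((cells N M n).card : ℝ) ≤ 14 * N.card * M + n / 2 ^ M + 1 := by
  classical
  let T : Finset (ℕ × ℤ) := (Finset.Ico (0 : ℤ) (n / 2 ^ M + 1)).image (fun a => (M, a))
  let Lo : Finset (ℕ × ℤ) := (Finset.range M ×ˢ N ×ˢ Finset.Icc (-8 : ℤ) 5).image
    (fun p => (p.1, 2 * (p.2.1 / 2 ^ (p.1 + 1)) + p.2.2))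
  have hsub : cells N M n ⊆ T ∪ Lo := by
    rintro ⟨l, a⟩ hc
    rw [mem_cells] at hc
    obtain ⟨h1, h2, h3, h4, h5⟩ := hc
    simp only at *
    rw [Finset.mem_union]
    by_cases hM : l = M
    · left
      subst hM
      refine Finset.mem_image.2 ⟨a, ?_, rfl⟩
      rw [Finset.mem_Ico]
      refine ⟨h2, ?_⟩
      have := (Int.le_ediv_iff_mul_le (c := 2 ^ l) (by positivity)).2 h3.le
      omega
    · right
      have h5' := h5.resolve_left hM
      unfold Adm at h5'
      push Not at h5'
      obtain ⟨ν, hν, g1, g2⟩ := h5'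
      refine Finset.mem_image.2 ⟨(l, ν, a - 2 * (ν / 2 ^ (l + 1))), ?_, by simp⟩
      simp only [Finset.mem_product, Finset.mem_range, Finset.mem_Icc]
      have hp : (0 : ℤ) < 2 ^ (l + 1) := by positivity
      have e1 := (Int.le_ediv_iff_mul_le hp).2 g1
      have e2 : ν / 2 ^ (l + 1) ≤ a / 2 + 4 := by
        have := Int.ediv_le_ediv hp g2
        rwa [Int.mul_ediv_cancel _ hp.ne'] at this
      refine ⟨by omega, hν, by omega, by omega⟩
  have c1 : ((cells N M n).card : ℝ) ≤ T.card + Lo.card := by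
    exact_mod_cast (Finset.card_le_card hsub).trans (Finset.card_union_le _ _)
  have c2 : (T.card : ℝ) ≤ n / 2 ^ M + 1 := by
    have : T.card ≤ n / 2 ^ M + 1 := by
      refine Finset.card_image_le.trans ?_
      rw [Int.card_Ico]
      have : ((n : ℤ) / 2 ^ M) = ((n / 2 ^ M : ℕ) : ℤ) := by simp
      rw [this]
      generalize n / 2 ^ M = z
      omega
    have h2 : ((n / 2 ^ M : ℕ) : ℝ) ≤ (n : ℝ) / ((2 ^ M : ℕ) : ℝ) := Nat.cast_div_le
    push_cast at h2
    have h3 : (T.card : ℝ) ≤ ((n / 2 ^ M : ℕ) : ℝ) + 1 := by exact_mod_cast this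
    linarith
  have c3 : (Lo.card : ℝ) ≤ 14 * N.card * M := by
    have : Lo.card ≤ 14 * N.card * M := by
      refine Finset.card_image_le.trans ?_
      rw [Finset.card_product, Finset.card_product, Finset.card_range, Int.card_Icc]
      have e14 : (5 + 1 - (-8 : ℤ)).toNat = 14 := rfl
      rw [e14]
      apply le_of_eq; ring
    exact_mod_cast this
  linarith

lemma cells_level {N : Finset ℤ} {M n : ℕ} {t : ℤ} {l l' : ℕ} {a a' : ℤ}
    (h : (l, a) ∈ cells N M n) (h' : (l', a') ∈ cells N M n) (hl : 1 ≤ l)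
    (ht : (a - 1) * 2 ^ l ≤ t ∧ t ≤ (a + 3) * 2 ^ l)
    (ht' : (a' - 1) * 2 ^ l' ≤ t ∧ t ≤ (a' + 3) * 2 ^ l') : l ≤ l' + 3 := by
  by_contra hcon
  rw [mem_cells] at h h'
  obtain ⟨h1, h2, h3, h4, h5⟩ := h
  obtain ⟨h1', h2', h3', h4', h5'⟩ := h'
  simp only at *
  have adm : Adm N l a := h4.resolve_left (by omega)
  have nadm := h5'.resolve_left (by omega)
  unfold Adm at nadm
  push Not at nadm
  obtain ⟨ν, hν, g1, g2⟩ := nadm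
  have hp : (0 : ℤ) < 2 ^ l' := by positivity
  have e1 : a' - 1 ≤ 2 * (a' / 2) := by omega
  have e2 : 2 * (a' / 2) ≤ a' := by omega
  rw [pow_succ] at g1 g2
  have f1 : (a' - 5) * 2 ^ l' ≤ ν := by nlinarith
  have f2 : ν ≤ (a' + 8) * 2 ^ l' := by nlinarith
  have h16 : (2 : ℤ) ^ l' * 16 ≤ 2 ^ l := by
    have : (2 : ℤ) ^ (l' + 4) ≤ 2 ^ l := pow_le_pow_right₀ (by norm_num) (by omega)
    rw [pow_add] at this; linarith
  apply adm ν hν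
  constructor <;> nlinarith

lemma cells_overlap (N : Finset ℤ) (M n : ℕ) (t : ℤ) :
    (((cells N M n).filter (fun c => 1 ≤ c.1)).filter
      (fun c => t ∈ Finset.Icc ((c.2 - 1) * 2 ^ c.1) ((c.2 + 3) * 2 ^ c.1))).card ≤ 20 := by
  classical
  set S := (((cells N M n).filter (fun c => 1 ≤ c.1)).filter
      (fun c => t ∈ Finset.Icc ((c.2 - 1) * 2 ^ c.1) ((c.2 + 3) * 2 ^ c.1))) with hS
  by_cases hne : S.Nonempty
  swap
  · rw [Finset.not_nonempty_iff_eq_empty.1 hne]; simp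
  obtain ⟨c0, hc0, hmin⟩ := Finset.exists_min_image S (fun c => c.1) hne
  have hsub : S ⊆ (Finset.Icc c0.1 (c0.1 + 3) ×ˢ Finset.Icc (-3 : ℤ) 1).image
      (fun p => (p.1, t / 2 ^ p.1 + p.2)) := by
    rintro ⟨l, a⟩ hc
    have hm := hmin _ hc
    rw [hS, Finset.mem_filter, Finset.mem_filter, Finset.mem_Icc] at hc hc0
    obtain ⟨⟨k1, k2⟩, k3⟩ := hc
    have lev := cells_level (N := N) (M := M) (n := n) (t := t) k1 hc0.1.1 k2 k3 hc0.2
    refine Finset.mem_image.2 ⟨(l, a - t / 2 ^ l), ?_, by simp⟩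
    simp only [Finset.mem_product, Finset.mem_Icc] at *
    have hp : (0 : ℤ) < 2 ^ l := by positivity
    have e1 := (Int.le_ediv_iff_mul_le hp).2 k3.1
    have e2 : t / 2 ^ l ≤ a + 3 := by
      have := Int.ediv_le_ediv hp k3.2
      rwa [Int.mul_ediv_cancel _ hp.ne'] at this
    omega
  refine (Finset.card_le_card hsub).trans (Finset.card_image_le.trans ?_)
  rw [Finset.card_product, Int.card_Icc, Nat.card_Icc]
  have e5 : (1 + 1 - (-3 : ℤ)).toNat = 5 := rfl
  rw [e5]
  omega

/-- admissible cells lie well inside `[0, n-r)` -/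
lemma cell_inside {N : Finset ℤ} {M n r : ℕ} (hrn : r ≤ n) (h0 : (-1 : ℤ) ∈ N)
    (h1 : ∀ t : ℤ, (n : ℤ) - r ≤ t → t < n → t ∈ N) (hr : 1 ≤ r) {c : ℕ × ℤ}
    (hc : c ∈ cells N M n) (hl : 1 ≤ c.1) :
    0 ≤ (c.2 - 2) * 2 ^ c.1 ∧ (c.2 + 4) * 2 ^ c.1 < (n : ℤ) - r := by
  rw [mem_cells] at hc
  obtain ⟨k1, k2, k3, k4, k5⟩ := hc
  have adm : Adm N c.1 c.2 := k4.resolve_left (by omega)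
  have hp : (0 : ℤ) < 2 ^ c.1 := by positivity
  constructor
  · by_contra hcon
    exact adm _ h0 ⟨by omega, by nlinarith⟩
  · by_contra hcon
    by_cases h : (c.2 - 2) * 2 ^ c.1 ≤ (n : ℤ) - r
    · exact adm _ (h1 ((n : ℤ) - r) le_rfl (by omega)) ⟨h, by omega⟩
    · refine adm _ (h1 (c.2 * 2 ^ c.1) (by nlinarith) k3) ⟨by nlinarith, by nlinarith⟩

/-- the smooth bump attached to a cell -/
def bump (c : ℕ × ℤ) : ℤ → ℝ := fun t =>
  chi ((t : ℝ) / 2 ^ c.1 - (c.2 - 1)) - chi ((t : ℝ) / 2 ^ c.1 - (c.2 + 1))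

lemma chi_mono : Monotone chi := Real.smoothTransition.monotone

lemma bump_nonneg (c : ℕ × ℤ) (t : ℤ) : 0 ≤ bump c t := by
  unfold bump
  have := chi_mono (show (t : ℝ) / 2 ^ c.1 - (c.2 + 1) ≤ (t : ℝ) / 2 ^ c.1 - (c.2 - 1) by linarith)
  linarith

lemma bump_le_one (c : ℕ × ℤ) (t : ℤ) : bump c t ≤ 1 := by
  unfold bump
  have h1 := Real.smoothTransition.le_one ((t : ℝ) / 2 ^ c.1 - (c.2 - 1))
  have h2 := Real.smoothTransition.nonneg ((t : ℝ) / 2 ^ c.1 - (c.2 + 1))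
  simp only [chi]; linarith

lemma bump_left {c : ℕ × ℤ} {t : ℤ} (h : t ≤ (c.2 - 1) * 2 ^ c.1) : bump c t = 0 := by
  have hp : (0 : ℝ) < 2 ^ c.1 := by positivity
  have h' : (t : ℝ) ≤ (c.2 - 1) * 2 ^ c.1 := by exact_mod_cast h
  have := (div_le_iff₀ hp).2 h'
  unfold bump chi
  rw [Real.smoothTransition.zero_of_nonpos (by linarith),
    Real.smoothTransition.zero_of_nonpos (by linarith), sub_zero]

lemma bump_right {c : ℕ × ℤ} {t : ℤ} (h : (c.2 + 2) * 2 ^ c.1 ≤ t) : bump c t = 0 := by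
  have hp : (0 : ℝ) < 2 ^ c.1 := by positivity
  have h' : ((c.2 : ℝ) + 2) * 2 ^ c.1 ≤ t := by exact_mod_cast h
  have := (le_div_iff₀ hp).2 h'
  unfold bump chi
  rw [Real.smoothTransition.one_of_one_le (by linarith),
    Real.smoothTransition.one_of_one_le (by linarith), sub_self]

lemma bump_one {c : ℕ × ℤ} {t : ℤ} (h : c.2 * 2 ^ c.1 ≤ t) (h2 : t ≤ (c.2 + 1) * 2 ^ c.1) :
    bump c t = 1 := by
  have hp : (0 : ℝ) < 2 ^ c.1 := by positivity
  have h' : (c.2 : ℝ) * 2 ^ c.1 ≤ t := by exact_mod_cast h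
  have h2' : (t : ℝ) ≤ (c.2 + 1) * 2 ^ c.1 := by exact_mod_cast h2
  have := (le_div_iff₀ hp).2 h'
  have := (div_le_iff₀ hp).2 h2'
  unfold bump chi
  rw [Real.smoothTransition.one_of_one_le (by linarith),
    Real.smoothTransition.zero_of_nonpos (by linarith), sub_zero]

lemma bump_bd_bound (r : ℕ) : ∃ A : ℝ, 0 < A ∧ ∀ (c : ℕ × ℤ) (t : ℤ),
    |(bdL ^ r) (bump c) t| ≤ A * (1 / 2 ^ c.1) ^ r := by
  obtain ⟨A, hA, hb⟩ := chi_deriv_bound r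
  refine ⟨2 * A, by positivity, ?_⟩
  intro c t
  have e : bump c = (fun s : ℤ => chi ((1 / 2 ^ c.1) * s + (-(c.2 - 1)))) -
      (fun s : ℤ => chi ((1 / 2 ^ c.1) * s + (-(c.2 + 1)))) := by
    funext s
    simp only [bump, Pi.sub_apply]
    congr 1 <;> (congr 1; ring)
  rw [e, map_sub, Pi.sub_apply]
  have b1 := bd_sample_bound r (1 / 2 ^ c.1) (-(c.2 - 1)) A (by positivity) chi
    (Real.smoothTransition.contDiff) hb t
  have b2 := bd_sample_bound r (1 / 2 ^ c.1) (-(c.2 + 1)) A (by positivity) chi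
    (Real.smoothTransition.contDiff) hb t
  refine (abs_sub _ _).trans ?_
  linarith

lemma bump_bd_supp (r : ℕ) (hr : 1 ≤ r) (c : ℕ × ℤ) (hc : r ≤ 2 ^ c.1) (t : ℤ)
    (ht : t ∉ Finset.Icc ((c.2 - 1) * 2 ^ c.1) ((c.2 + 3) * 2 ^ c.1)) :
    (bdL ^ r) (bump c) t = 0 := by
  rw [Finset.mem_Icc] at ht
  apply bd_zero_of_const r hr _ t 0
  intro s h1 h2
  by_cases h : (c.2 - 1) * 2 ^ c.1 ≤ t
  · apply bump_right
    have h3 : ¬ t ≤ (c.2 + 3) * 2 ^ c.1 := fun h' => ht ⟨h, h'⟩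
    have : (r : ℤ) ≤ 2 ^ c.1 := by exact_mod_cast hc
    nlinarith
  · apply bump_left; omega

def inCell (c : ℕ × ℤ) (t : ℤ) : Prop := c.2 * 2 ^ c.1 ≤ t ∧ t < (c.2 + 1) * 2 ^ c.1

open Classical in
lemma cell_sum (N : Finset ℤ) (M n : ℕ) (i : ℕ) (hi : i < n) (f : (ℕ × ℤ) → ℝ)
    (hf : ∀ c ∈ cells N M n, ¬ inCell c i → f c = 0) :
    ∃ c ∈ cells N M n, inCell c i ∧ ∑ c ∈ cells N M n, f c = f c := by
  obtain ⟨c, hc, hm, hu⟩ := cell_unique_mem N M n i hi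
  refine ⟨c, hc, hm, ?_⟩
  apply Finset.sum_eq_single_of_mem c hc
  intro c' hc' hne
  exact hf c' hc' (hu c' hc' hne)

open Classical in
lemma cell_sum_sq (N : Finset ℤ) (M n : ℕ) (p : (ℕ × ℤ) → ℤ → ℝ)
    (hp : ∀ c ∈ cells N M n, ∀ t, ¬ inCell c t → p c t = 0) :
    ∑ i ∈ Finset.range n, (∑ c ∈ cells N M n, p c i) ^ 2 =
      ∑ c ∈ cells N M n, ∑ i ∈ Finset.range n, p c i ^ 2 := by
  rw [Finset.sum_comm]
  apply Finset.sum_congr rfl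
  intro i hi
  rw [Finset.mem_range] at hi
  obtain ⟨c, hc, hm, hu⟩ := cell_unique_mem N M n i hi
  rw [Finset.sum_eq_single_of_mem c hc, Finset.sum_eq_single_of_mem c hc]
  · intro c' hc' hne
    rw [hp c' hc' i (hu c' hc' hne)]; simp
  · intro c' hc' hne
    exact hp c' hc' i (hu c' hc' hne)

lemma bound_aux {Λ s φ a w : ℝ} (hΛ : 0 ≤ Λ) (hs : |s| ≤ 1) (hφ : 2 * φ ≤ Λ) (ha : |a| ≤ φ)
    (hw : |w| ≤ φ) (h1 : 0 < s → a = φ) (h2 : s < 0 → a = - φ) : |Λ * s - a + w| ≤ Λ := by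
  rw [abs_le] at *
  rcases lt_trichotomy s 0 with h | h | h
  · rw [h2 h]; constructor <;> nlinarith
  · subst h; constructor <;> linarith
  · rw [h1 h]; constructor <;> nlinarith

lemma e4_aux {Λ : ℝ} (hΛ : 0 < Λ) (K b A y : ℝ) : Λ ^ 2 * ((20 : ℕ) * (K * (b / Λ * (A * y)) ^ 2)) =
    20 * A ^ 2 * (b ^ 2 * (K * y ^ 2)) := by
  push_cast
  field_simp

set_option maxHeartbeats 2000000 in
lemma det_assembly (r : ℕ) (hr : 1 ≤ r) : ∃ C : ℝ, 0 < C ∧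
    ∀ (n : ℕ), r ≤ n → ∀ (k : ℕ) (τ : ℕ → ℤ) (lam v : ℕ → ℝ),
    (∀ i ≤ k, τ i < τ (i + 1)) → (∀ i, 1 ≤ lam i) →
    (∀ i ≤ k, (τ i : ℝ) + lam i ≤ τ (i + 1)) → (∀ i, v i = 0 ∨ v i = 1 ∨ v i = -1) →
    v 0 = 0 → v (k + 1) = 0 → τ 0 = -1 → τ (k + 1) = ((n - r : ℕ) : ℤ) →
    ∀ (N : Finset ℤ) (M : ℕ), (∀ i ≤ k + 1, τ i ∈ N) → (∀ i ≤ k, crossing τ lam i ∈ N) →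
    (∀ t : ℤ, (n : ℤ) - r ≤ t → t < n → t ∈ N) →
    ∀ θ e x : Fin n → ℝ, Dl1 r e ≤ Dl1 r θ →
    (∀ t : ℕ, t < n - r → DD r θ t ≠ 0 → ∃ i ≤ k, τ i = t ∧ v i * DD r θ t = |DD r θ t|) →
    ∀ (Λ : ℝ), 0 < Λ → ∀ (p w : (ℕ × ℤ) → ℤ → ℝ) (b : (ℕ × ℤ) → ℝ),
    (∀ c ∈ cells N M n, 0 ≤ b c ∧ 40 * b c ≤ Λ ∧
      (∀ t, ¬ inCell c t → p c t = 0) ∧ (∀ t, ¬ inCell c t → w c t = 0) ∧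
      (∀ t, |w c t| ≤ b c) ∧
      (∀ i : Fin n, inCell c i.1 → x i = p c i.1 + (-1) ^ r * (bdL ^ r) (w c) i.1) ∧
      (∀ i : Fin n, ¬ inCell c i.1 → (bdL ^ r) (w c) i.1 = 0) ∧
      (¬ (1 ≤ c.1 ∧ r ≤ 2 ^ c.1) → b c = 0)) →
    2 * ∑ i, x i * (e - θ) i - ∑ i, (e - θ) i ^ 2 ≤
      C * (∑ c ∈ cells N M n, (∑ i ∈ Finset.range n, p c i ^ 2 +
        b c ^ 2 * (2 ^ c.1 : ℝ) ^ (1 - 2 * (r : ℤ)))) +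
      C * Λ ^ 2 * ∑ i ∈ Finset.range (k + 1),
        if v i ≠ v (i + 1) then lam i ^ (1 - 2 * (r : ℤ)) else 0 := by
  classical
  obtain ⟨A, hA, hAb⟩ := bump_bd_bound r
  obtain ⟨Cs, hCs, hCsb⟩ := skel_energy r hr
  refine ⟨2 + 400 * A ^ 2 + 4 * Cs, by positivity, ?_⟩
  intro n hrn k τ lam v hτ hl1 hlL hv hv0 hv1 hτ0 hτ1 N M hNτ hNc hNe θ e x hD hθ Λ hΛ p w b hc
  have hl : ∀ i, 0 < lam i := fun i => by linarith [hl1 i]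
  have hvb : ∀ i, |v i| ≤ 1 := by
    intro i; rcases hv i with h | h | h <;> rw [h] <;> simp
  have hN0 : (-1 : ℤ) ∈ N := hτ0 ▸ hNτ 0 (by omega)
  set S := cells N M n with hS
  set sk := skel k τ lam v with hsk
  set S1 := S.filter (fun c => 1 ≤ c.1 ∧ r ≤ 2 ^ c.1) with hS1
  have hS1sub : ∀ c ∈ S1, c ∈ S ∧ 1 ≤ c.1 ∧ r ≤ 2 ^ c.1 := by
    intro c h; exact Finset.mem_filter.1 h
  have hadm : ∀ c ∈ S1, Adm N c.1 c.2 := by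
    intro c h
    obtain ⟨h1, h2, -⟩ := hS1sub c h
    exact ((mem_cells.1 h1).2.2.2.1).resolve_left (by omega)
  -- signs
  have heps : ∀ c, ∃ ε : ℝ, (ε = 1 ∨ ε = -1) ∧ (c ∈ S1 → ∀ t, (c.2 - 2) * 2 ^ c.1 ≤ t →
      t ≤ (c.2 + 4) * 2 ^ c.1 → 0 ≤ ε * sk t) := by
    intro c
    by_cases h : c ∈ S1
    · have had := hadm c h
      rcases skel_sign hτ hl hlL hv0 hv1 hv ((c.2 - 2) * 2 ^ c.1) ((c.2 + 4) * 2 ^ c.1)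
        (fun i hi => had _ (hNτ i hi)) (fun i hi => had _ (hNc i hi)) with g | g
      · exact ⟨1, Or.inl rfl, fun _ t h1 h2 => by rw [one_mul]; exact g t h1 h2⟩
      · exact ⟨-1, Or.inr rfl, fun _ t h1 h2 => by have := g t h1 h2; rw [hsk]; linarith⟩
    · exact ⟨1, Or.inl rfl, fun h' => absurd h' h⟩
  choose ε hε1 hε2 using heps
  have hεa : ∀ c, |ε c| = 1 := by
    intro c; rcases hε1 c with h | h <;> rw [h] <;> simp
  set f : ℤ → ℝ := ∑ c ∈ S1, (ε c * b c / Λ) • bump c with hf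
  have hfapp : ∀ t, f t = ∑ c ∈ S1, ε c * b c / Λ * bump c t := by
    intro t; rw [hf, Finset.sum_apply]; rfl
  set W : ℤ → ℝ := ∑ c ∈ S, w c with hW
  have hwz : ∀ c ∈ S, c ∉ S1 → ∀ t, w c t = 0 := by
    intro c h1 h2 t
    obtain ⟨_, _, _, _, g, _, _, gb⟩ := hc c h1
    have : b c = 0 := gb (fun h => h2 (Finset.mem_filter.2 ⟨h1, h⟩))
    have h3 := g t
    rw [this] at h3
    exact abs_eq_zero.1 (le_antisymm h3 (abs_nonneg _))
  have hWapp : ∀ t, W t = ∑ c ∈ S1, w c t := by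
    intro t; rw [hW, Finset.sum_apply]
    symm
    apply Finset.sum_subset (Finset.filter_subset _ _)
    intro c h1 h2; exact hwz c h1 h2 t
  have hwb : ∀ c ∈ S1, ∀ t, |w c t| ≤ b c * bump c t := by
    intro c h t
    obtain ⟨g0, _, _, gw, g, _, _, gb⟩ := hc c (hS1sub c h).1
    by_cases hi : inCell c t
    · rw [bump_one hi.1 hi.2.le, mul_one]; exact g t
    · rw [gw t hi, abs_zero]; exact mul_nonneg g0 (bump_nonneg c t)
  have hbz : ∀ c ∈ S1, ∀ t, ¬ ((c.2 - 2) * 2 ^ c.1 ≤ t ∧ t ≤ (c.2 + 4) * 2 ^ c.1) → bump c t = 0 := by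
    intro c h t ht
    have hp : (0 : ℤ) < 2 ^ c.1 := by positivity
    by_cases h1 : (c.2 - 2) * 2 ^ c.1 ≤ t
    · apply bump_right
      have : ¬ t ≤ (c.2 + 4) * 2 ^ c.1 := fun h' => ht ⟨h1, h'⟩
      nlinarith
    · apply bump_left; nlinarith
  have hbz' : ∀ c ∈ S1, ∀ t, t ∉ Finset.Icc ((c.2 - 1) * 2 ^ c.1) ((c.2 + 3) * 2 ^ c.1) → bump c t = 0 := by
    intro c h t ht
    have hp : (0 : ℤ) < 2 ^ c.1 := by positivity
    rw [Finset.mem_Icc] at ht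
    by_cases h1 : (c.2 - 1) * 2 ^ c.1 ≤ t
    · apply bump_right
      have : ¬ t ≤ (c.2 + 3) * 2 ^ c.1 := fun h' => ht ⟨h1, h'⟩
      nlinarith
    · apply bump_left; nlinarith
  -- if all bumps vanish
  have hzero : ∀ t, (∀ c ∈ S1, bump c t = 0) → f t = 0 ∧ W t = 0 := by
    intro t h
    constructor
    · rw [hfapp]; apply Finset.sum_eq_zero; intro c hc; rw [h c hc, mul_zero]
    · rw [hWapp]; apply Finset.sum_eq_zero; intro c hc
      have := hwb c hc t
      rw [h c hc, mul_zero] at this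
      exact abs_eq_zero.1 (le_antisymm this (abs_nonneg _))
  have hlt0 : ∀ t < 0, f t = 0 ∧ W t = 0 := by
    intro t ht
    apply hzero; intro c hc
    apply hbz c hc
    have := cell_inside hrn hN0 hNe hr (hS1sub c hc).1 (hS1sub c hc).2.1
    omega
  have hge : ∀ t, ((n - r : ℕ) : ℤ) ≤ t → f t = 0 ∧ W t = 0 := by
    intro t ht
    apply hzero; intro c hc
    apply hbz c hc
    have := cell_inside hrn hN0 hNe hr (hS1sub c hc).1 (hS1sub c hc).2.1
    omega
  have hover : ∀ t : ℤ, (S1.filter (fun c => t ∈ Finset.Icc ((c.2 - 1) * 2 ^ c.1) ((c.2 + 3) * 2 ^ c.1))).card ≤ 20 := by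
    intro t
    refine le_trans (Finset.card_le_card ?_) (cells_overlap N M n t)
    apply Finset.filter_subset_filter
    intro c hc
    have := hS1sub c hc
    exact Finset.mem_filter.2 ⟨this.1, this.2.1⟩
  have hphi : ∀ t, 2 * ∑ c ∈ S1, b c * bump c t ≤ Λ := by
    intro t
    have e1 : ∑ c ∈ S1, b c * bump c t =
        ∑ c ∈ S1.filter (fun c => t ∈ Finset.Icc ((c.2 - 1) * 2 ^ c.1) ((c.2 + 3) * 2 ^ c.1)), b c * bump c t := by
      symm
      apply Finset.sum_subset (Finset.filter_subset _ _)
      intro c h1 h2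
      rw [hbz' c h1 t (fun h => h2 (Finset.mem_filter.2 ⟨h1, h⟩)), mul_zero]
    have e2 : ∑ c ∈ S1.filter (fun c => t ∈ Finset.Icc ((c.2 - 1) * 2 ^ c.1) ((c.2 + 3) * 2 ^ c.1)), b c * bump c t
        ≤ (S1.filter (fun c => t ∈ Finset.Icc ((c.2 - 1) * 2 ^ c.1) ((c.2 + 3) * 2 ^ c.1))).card • (Λ / 40) := by
      apply Finset.sum_le_card_nsmul
      intro c h
      obtain ⟨g0, g1, _⟩ := hc c (hS1sub c (Finset.mem_filter.1 h).1).1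
      have := bump_nonneg c t
      have := bump_le_one c t
      nlinarith
    have e3 : ((S1.filter (fun c => t ∈ Finset.Icc ((c.2 - 1) * 2 ^ c.1) ((c.2 + 3) * 2 ^ c.1))).card : ℝ) ≤ 20 := by
      exact_mod_cast hover t
    rw [nsmul_eq_mul] at e2
    rw [e1]
    nlinarith
  have hmain := pathwise hrn θ e x hD (fun t => ∑ c ∈ S, p c t) W (sk - f) Λ hΛ.le ?_ ?_ ?_ ?_ ?_ ?_ ?_
  · refine hmain.trans ?_
    have E1 : ∑ i ∈ Finset.range n, (∑ c ∈ S, p c i) ^ 2 = ∑ c ∈ S, ∑ i ∈ Finset.range n, p c i ^ 2 :=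
      cell_sum_sq N M n p (fun c h => (hc c h).2.2.1)
    have E2 := hCsb k τ lam v hτ hl1 hlL hvb n
    have E3 : ∑ t ∈ Finset.range n, ((bdL ^ r) f t) ^ 2 ≤
        (20 : ℕ) * ∑ c ∈ S1, ((Finset.Icc ((c.2 - 1) * 2 ^ c.1) ((c.2 + 3) * 2 ^ c.1)).card : ℝ) *
          (b c / Λ * (A * (1 / 2 ^ c.1) ^ r)) ^ 2 := by
      have := energy_overlap S1 (fun c => (ε c * b c / Λ) • (bdL ^ r) (bump c))
        (fun c => Finset.Icc ((c.2 - 1) * 2 ^ c.1) ((c.2 + 3) * 2 ^ c.1))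
        (fun c => b c / Λ * (A * (1 / 2 ^ c.1) ^ r)) 20 ?_ ?_ hover n
      · refine le_trans (le_of_eq ?_) this
        apply Finset.sum_congr rfl; intro t _
        rw [hf, map_sum, Finset.sum_apply]
        simp only [map_smul]
      · intro c h t ht
        rw [Pi.smul_apply, bump_bd_supp r hr c (hS1sub c h).2.2 t ht, smul_zero]
      · intro c h t
        obtain ⟨g0, _⟩ := hc c (hS1sub c h).1
        rw [Pi.smul_apply, smul_eq_mul, abs_mul, abs_div, abs_mul, hεa, one_mul, abs_of_nonneg g0,
          abs_of_pos hΛ]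
        exact mul_le_mul_of_nonneg_left (hAb c t) (by positivity)
    have E4 : Λ ^ 2 * ∑ t ∈ Finset.range n, ((bdL ^ r) f t) ^ 2 ≤
        100 * A ^ 2 * ∑ c ∈ S, b c ^ 2 * (2 ^ c.1 : ℝ) ^ (1 - 2 * (r : ℤ)) := by
      refine (mul_le_mul_of_nonneg_left E3 (by positivity)).trans ?_
      have hss : ∑ c ∈ S1, b c ^ 2 * (2 ^ c.1 : ℝ) ^ (1 - 2 * (r : ℤ)) ≤
          ∑ c ∈ S, b c ^ 2 * (2 ^ c.1 : ℝ) ^ (1 - 2 * (r : ℤ)) := by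
        apply Finset.sum_le_sum_of_subset_of_nonneg (Finset.filter_subset _ _)
        intro c _ _; positivity
      refine le_trans ?_ (mul_le_mul_of_nonneg_left hss (by positivity))
      rw [Finset.mul_sum, Finset.mul_sum, Finset.mul_sum]
      apply Finset.sum_le_sum
      intro c _
      have hcard : ((Finset.Icc ((c.2 - 1) * 2 ^ c.1) ((c.2 + 3) * 2 ^ c.1)).card : ℝ) ≤ 5 * 2 ^ c.1 := by
        rw [Int.card_Icc]
        have e : (c.2 + 3) * 2 ^ c.1 + 1 - (c.2 - 1) * 2 ^ c.1 = ((4 * 2 ^ c.1 + 1 : ℕ) : ℤ) := by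
          push_cast; ring
        rw [e, Int.toNat_natCast]
        push_cast
        have : (1 : ℝ) ≤ 2 ^ c.1 := one_le_pow₀ (by norm_num)
        linarith
      rw [← zpow_aux r (2 ^ c.1) (by positivity)]
      have : Λ ^ 2 * ((20 : ℕ) * (((Finset.Icc ((c.2 - 1) * 2 ^ c.1) ((c.2 + 3) * 2 ^ c.1)).card : ℝ) *
          (b c / Λ * (A * (1 / 2 ^ c.1) ^ r)) ^ 2)) =
          20 * A ^ 2 * (b c ^ 2 * (((Finset.Icc ((c.2 - 1) * 2 ^ c.1) ((c.2 + 3) * 2 ^ c.1)).card : ℝ) * ((1 / 2 ^ c.1) ^ r) ^ 2)) := by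
        exact e4_aux hΛ _ _ _ _
      rw [this]
      have h3 : 20 * A ^ 2 * (b c ^ 2 * (((Finset.Icc ((c.2 - 1) * 2 ^ c.1) ((c.2 + 3) * 2 ^ c.1)).card : ℝ) * ((1 / 2 ^ c.1) ^ r) ^ 2))
          ≤ 20 * A ^ 2 * (b c ^ 2 * (5 * 2 ^ c.1 * ((1 / 2 ^ c.1) ^ r) ^ 2)) := by
        gcongr
      refine h3.trans (le_of_eq ?_)
      ring
    have E5 : ∑ t ∈ Finset.range n, ((bdL ^ r) (sk - f) t) ^ 2 ≤
        2 * ∑ t ∈ Finset.range n, ((bdL ^ r) sk t) ^ 2 + 2 * ∑ t ∈ Finset.range n, ((bdL ^ r) f t) ^ 2 := by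
      rw [Finset.mul_sum, Finset.mul_sum, ← Finset.sum_add_distrib]
      apply Finset.sum_le_sum; intro t _
      rw [map_sub, Pi.sub_apply]
      nlinarith [sq_nonneg ((bdL ^ r) sk t + (bdL ^ r) f t)]
    rw [E1, Finset.sum_add_distrib]
    set P := ∑ c ∈ S, ∑ i ∈ Finset.range n, p c i ^ 2
    set Q := ∑ c ∈ S, b c ^ 2 * (2 ^ c.1 : ℝ) ^ (1 - 2 * (r : ℤ))
    set Z := ∑ i ∈ Finset.range (k + 1), if v i ≠ v (i + 1) then lam i ^ (1 - 2 * (r : ℤ)) else 0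
    have hP : 0 ≤ P := Finset.sum_nonneg fun _ _ => Finset.sum_nonneg fun _ _ => sq_nonneg _
    have hQ : 0 ≤ Q := Finset.sum_nonneg fun c _ => by positivity
    have hZ : 0 ≤ Z := Finset.sum_nonneg fun i _ => by
      have := hl i
      split_ifs <;> positivity
    have E6 := mul_le_mul_of_nonneg_left E5 (show 0 ≤ 2 * Λ ^ 2 by positivity)
    have E7 := mul_le_mul_of_nonneg_left E2 (show 0 ≤ 4 * Λ ^ 2 by positivity)
    have hΛZ : 0 ≤ Λ ^ 2 * Z := by positivity
    have X1 : 0 ≤ A ^ 2 * P := by positivity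
    have X2 : 0 ≤ Cs * P := by positivity
    have X3 : 0 ≤ Cs * Q := by positivity
    have X4 : 0 ≤ A ^ 2 * (Λ ^ 2 * Z) := by positivity
    have X5 : 0 ≤ A ^ 2 * Q := by positivity
    have X6 : 0 ≤ Cs * (Λ ^ 2 * Z) := by positivity
    nlinarith
  · intro i
    have h1 : ((-1 : ℝ)) ^ r * (bdL ^ r) W i.1 = ∑ c ∈ S, (-1) ^ r * (bdL ^ r) (w c) i.1 := by
      rw [hW, map_sum, Finset.sum_apply, Finset.mul_sum]
    rw [h1, ← Finset.sum_add_distrib]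
    obtain ⟨c, hcc, hin, hsum⟩ := cell_sum N M n i.1 i.2
      (fun c => p c i.1 + (-1) ^ r * (bdL ^ r) (w c) i.1) (by
        intro c h hn
        obtain ⟨_, _, gp, _, _, _, gw, _⟩ := hc c h
        rw [gp _ hn, gw i hn]; simp)
    rw [hsum]
    exact (hc c hcc).2.2.2.2.2.1 i hin
  · intro t ht; exact (hlt0 t ht).2
  · intro t ht; exact (hge t ht).2
  · intro t ht
    rw [Pi.sub_apply, (hlt0 t ht).1, hsk, skel_left hτ hl (by omega), sub_zero]
  · intro t ht
    rw [Pi.sub_apply, (hge t ht).1, hsk, skel_right hτ hl hlL hv0 hv1 (by omega), sub_zero]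
  · intro t _
    have e1 : Λ * (sk - f) t + W t = Λ * sk t - (∑ c ∈ S1, ε c * (b c * bump c t)) + W t := by
      rw [Pi.sub_apply, mul_sub, hfapp, Finset.mul_sum]
      congr 2
      apply Finset.sum_congr rfl; intro c _
      field_simp
    rw [e1]
    have hact : ∀ c ∈ S1, bump c t ≠ 0 → 0 ≤ ε c * sk t := by
      intro c h hb
      have : (c.2 - 2) * 2 ^ c.1 ≤ (t : ℤ) ∧ (t : ℤ) ≤ (c.2 + 4) * 2 ^ c.1 := by
        by_contra hcon; exact hb (hbz c h t hcon)
      exact hε2 c h t this.1 this.2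
    apply bound_aux hΛ.le (skel_bound hτ hl hlL hv0 hv1 hvb t) (hphi t)
    · refine (Finset.abs_sum_le_sum_abs _ _).trans ?_
      apply Finset.sum_le_sum; intro c h
      have g0 := (hc c (hS1sub c h).1).1
      rw [abs_mul, hεa, one_mul, abs_of_nonneg (mul_nonneg g0 (bump_nonneg c t))]
    · rw [hWapp]
      refine (Finset.abs_sum_le_sum_abs _ _).trans ?_
      apply Finset.sum_le_sum; intro c h
      exact hwb c h t
    · intro hpos
      apply Finset.sum_congr rfl; intro c h
      by_cases hb : bump c t = 0
      · rw [hb]; ring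
      · have := hact c h hb
        rcases hε1 c with g | g
        · rw [g, one_mul]
        · rw [g] at this; exfalso; change 0 < sk t at hpos; linarith
    · intro hneg
      rw [← Finset.sum_neg_distrib]
      apply Finset.sum_congr rfl; intro c h
      by_cases hb : bump c t = 0
      · rw [hb]; ring
      · have := hact c h hb
        rcases hε1 c with g | g
        · rw [g] at this; exfalso; change sk t < 0 at hneg; linarith
        · rw [g]; ring
  · intro t ht
    by_cases h0 : DD r θ t = 0
    · rw [h0]; simp
    obtain ⟨i, hi, hτi, hvi⟩ := hθ t ht h0
    have hz := hzero t (by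
      intro c h
      apply hbz c h
      exact hadm c h t (hτi ▸ hNτ i (by omega)))
    rw [Pi.sub_apply, hz.1, hz.2, ← hτi, hsk, skel_knot hτ hl hlL hv0 hi, ← hvi]
    ring

/-- Standard Gaussian measure. -/
abbrev gv (n : ℕ) : Measure (Fin n → ℝ) := Measure.pi fun _ => gaussianReal 0 1

lemma gaussVec_one (n : ℕ) : gaussVec n 1 = gv n := by
  unfold gaussVec gv; simp

lemma gaussVec_scale (n : ℕ) (σ : ℝ) :
    MeasurePreserving (fun (x : Fin n → ℝ) i => σ * x i) (gv n) (gaussVec n σ) := by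
  unfold gaussVec gv
  apply measurePreserving_pi
  intro i
  refine ⟨by fun_prop, ?_⟩
  rw [gaussianReal_map_const_mul, mul_zero, mul_one]
  congr 1
  ext
  simp [Real.toNNReal_of_nonneg (sq_nonneg σ)]

lemma gv_precomp {n ℓ : ℕ} (φ : Fin ℓ → Fin n) (hφ : Function.Injective φ) :
    MeasurePreserving (fun (x : Fin n → ℝ) i => x (φ i)) (gv n) (gv ℓ) := by
  refine ⟨by fun_prop, ?_⟩
  have h := iIndepFun_pi (μ := fun _ : Fin n => gaussianReal 0 1) (X := fun _ x => x) (fun i => by fun_prop)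
  have h2 := (h.precomp hφ).map_fun_eq_pi_map (fun i => (measurable_pi_apply (φ i)).aemeasurable)
  refine h2.trans ?_
  unfold gv
  congr 1
  funext i
  exact (measurePreserving_eval (fun _ : Fin n => gaussianReal 0 1) (φ i)).map_eq

lemma gv_flip {n : ℕ} (j : Fin n) :
    MeasurePreserving (fun (x : Fin n → ℝ) i => if i = j then - x i else x i) (gv n) (gv n) := by
  have := measurePreserving_pi (fun _ : Fin n => gaussianReal 0 1) (fun _ : Fin n => gaussianReal 0 1)
    (f := fun i x => if i = j then - x else x) (by
      intro i
      by_cases h : i = j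
      · simp only [h, if_true]
        refine ⟨by fun_prop, ?_⟩
        rw [gaussianReal_map_neg, neg_zero]
      · simp only [h, if_false]
        exact MeasurePreserving.id _)
  exact this

lemma coord_memLp {n : ℕ} (i : Fin n) : MemLp (fun x : Fin n → ℝ => x i) 2 (gv n) := by
  have := (memLp_id_gaussianReal' (μ := 0) (v := 1) 2 (by simp)).comp_measurePreserving
    (measurePreserving_eval (fun _ : Fin n => gaussianReal 0 1) i)
  exact this

lemma lin_memLp {n : ℕ} (g : Fin n → ℝ) : MemLp (fun x : Fin n → ℝ => ∑ i, g i * x i) 2 (gv n) := by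
  apply memLp_finsetSum
  intro i _
  exact (coord_memLp i).const_mul (g i)

lemma lin_sq_integrable {n : ℕ} (g : Fin n → ℝ) :
    Integrable (fun x : Fin n → ℝ => (∑ i, g i * x i) ^ 2) (gv n) := (lin_memLp g).integrable_sq

lemma lin_sq_integral {n : ℕ} (g : Fin n → ℝ) :
    ∫ x, (∑ i, g i * x i) ^ 2 ∂gv n = ∑ i, g i ^ 2 := by
  have hmem : ∀ i, MemLp (fun x : ℝ => g i * x) 2 (gaussianReal 0 1) := fun i =>
    (memLp_id_gaussianReal' (μ := 0) (v := 1) 2 (by simp)).const_mul (g i)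
  have h := variance_sum_pi (μ := fun _ : Fin n => gaussianReal 0 1) (X := fun i x => g i * x) hmem
  have e : (∑ i, fun ω : Fin n → ℝ => g i * ω i) = fun x => ∑ i, g i * x i := by
    funext x; simp
  rw [e] at h
  have hmean : ∫ x, (∑ i, g i * x i) ∂gv n = 0 := by
    rw [integral_finsetSum]
    · apply Finset.sum_eq_zero
      intro i _
      rw [integral_const_mul]
      have := (measurePreserving_eval (fun _ : Fin n => gaussianReal 0 1) i)
      have h2 : ∫ x : Fin n → ℝ, x i ∂gv n = ∫ x, x ∂gaussianReal 0 1 := by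
        rw [← this.map_eq, integral_map this.measurable.aemeasurable (by fun_prop)]
      rw [h2, integral_id_gaussianReal, mul_zero]
    · intro i _
      exact ((coord_memLp i).const_mul (g i)).integrable (by norm_num)
  rw [variance_of_integral_eq_zero (lin_memLp g).aemeasurable hmean] at h
  refine h.trans ?_
  apply Finset.sum_congr rfl
  intro i _
  rw [variance_const_mul, variance_fun_id_gaussianReal]; simp

lemma exp_lin_integrable {n : ℕ} (g : Fin n → ℝ) :
    Integrable (fun x : Fin n → ℝ => Real.exp (∑ i, g i * x i)) (gv n) := by
  simp_rw [Real.exp_sum]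
  exact Integrable.fintype_prod (f := fun i x => Real.exp (g i * x)) fun i => integrable_exp_mul_gaussianReal (g i)

lemma exp_lin_integral {n : ℕ} (g : Fin n → ℝ) :
    ∫ x, Real.exp (∑ i, g i * x i) ∂gv n = Real.exp ((∑ i, g i ^ 2) / 2) := by
  simp_rw [Real.exp_sum]
  unfold gv
  rw [integral_fintype_prod_eq_prod (f := fun i x => Real.exp (g i * x))]
  rw [Finset.sum_div, Real.exp_sum]
  apply Finset.prod_congr rfl
  intro i _
  have := congrFun (mgf_id_gaussianReal (μ := 0) (v := 1)) (g i)
  simp only [mgf, id] at this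
  rw [this]; simp

/-! Doob maximal inequality -/

def psum {n : ℕ} (t : ℕ) (y : Fin n → ℝ) : ℝ := ∑ i ∈ Finset.range t, pad y i

def rmax {n : ℕ} : ℕ → (Fin n → ℝ) → ℝ
  | 0, _ => 0
  | t + 1, y => max (rmax t y) |psum (t + 1) y|

def sg1 (s : ℝ) : ℝ := if 0 ≤ s then 1 else -1

lemma rmax_nonneg {n : ℕ} (t : ℕ) (y : Fin n → ℝ) : 0 ≤ rmax t y := by
  induction t with
  | zero => exact le_rfl
  | succ t ih => exact le_max_of_le_left ih

lemma rmax_mono {n : ℕ} (y : Fin n → ℝ) {s t : ℕ} (h : s ≤ t) : rmax s y ≤ rmax t y := by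
  induction t, h using Nat.le_induction with
  | base => exact le_rfl
  | succ t _ ih => exact le_max_of_le_left ih

lemma psum_le_rmax {n : ℕ} (y : Fin n → ℝ) {s t : ℕ} (h : s ≤ t) : |psum s y| ≤ rmax t y := by
  refine le_trans ?_ (rmax_mono y h)
  cases s with
  | zero => simp [psum, rmax]
  | succ s => exact le_max_right _ _

lemma sg1_ineq (s x : ℝ) : |s| + sg1 s * x ≤ |s + x| := by
  unfold sg1
  split_ifs with h
  · rw [abs_of_nonneg h]; linarith [le_abs_self (s + x)]
  · rw [abs_of_neg (not_le.1 h)]; linarith [neg_le_abs (s + x)]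

lemma doob_path {n : ℕ} (y : Fin n → ℝ) (t : ℕ) :
    ∑ i ∈ Finset.range t, rmax i y * (sg1 (psum i y) * pad y i) ≤
      rmax t y * |psum t y| - rmax t y ^ 2 / 2 := by
  induction t with
  | zero => simp [rmax]
  | succ t ih =>
    rw [Finset.sum_range_succ]
    have h1 : psum (t + 1) y = psum t y + pad y t := by unfold psum; rw [Finset.sum_range_succ]
    have h2 := sg1_ineq (psum t y) (pad y t)
    rw [← h1] at h2
    have h3 : rmax (t + 1) y = max (rmax t y) |psum (t + 1) y| := rfl
    have h4 := rmax_nonneg t y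
    rcases le_total (rmax t y) |psum (t + 1) y| with h | h
    · rw [h3, max_eq_right h]
      nlinarith [sq_nonneg (rmax t y - |psum (t + 1) y|)]
    · rw [h3, max_eq_left h]
      nlinarith

def doobF {n : ℕ} (y : Fin n → ℝ) : ℝ :=
  4 * psum n y ^ 2 - 4 * ∑ i ∈ Finset.range n, rmax i y * (sg1 (psum i y) * pad y i)

lemma doob_bound {n : ℕ} (y : Fin n → ℝ) {t : ℕ} (h : t ≤ n) : psum t y ^ 2 ≤ doobF y := by
  have h1 := doob_path y n
  have h2 := psum_le_rmax y h
  have h3 : rmax n y ^ 2 ≤ doobF y := by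
    unfold doobF
    nlinarith [sq_nonneg (2 * |psum n y| - rmax n y), sq_abs (psum n y)]
  have h4 : psum t y ^ 2 ≤ rmax n y ^ 2 := by
    rw [← sq_abs]; gcongr
  linarith

lemma pad_memLp {n : ℕ} (i : ℕ) : MemLp (fun y : Fin n → ℝ => pad y i) 2 (gv n) := by
  unfold pad
  by_cases h : i < n
  · simp only [h, dite_true]; exact coord_memLp _
  · simp only [h, dite_false]; exact memLp_const 0

lemma psum_memLp {n : ℕ} (t : ℕ) : MemLp (fun y : Fin n → ℝ => psum t y) 2 (gv n) := by
  unfold psum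
  apply memLp_finsetSum
  intro i _; exact pad_memLp i

lemma pad_meas {n : ℕ} (i : ℕ) : Measurable (fun y : Fin n → ℝ => pad y i) := by
  unfold pad
  by_cases h : i < n
  · simp only [h, dite_true]; fun_prop
  · simp only [h, dite_false]; fun_prop

lemma psum_meas {n : ℕ} (t : ℕ) : Measurable (fun y : Fin n → ℝ => psum t y) := by
  unfold psum
  exact Finset.measurable_sum _ fun i _ => pad_meas i

lemma rmax_memLp {n : ℕ} (t : ℕ) : MemLp (fun y : Fin n → ℝ => rmax t y) 2 (gv n) := by
  induction t with
  | zero => exact memLp_const 0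
  | succ t ih => exact ih.sup (psum_memLp (t + 1)).abs

lemma sg_pad_memLp {n : ℕ} (i : ℕ) :
    MemLp (fun y : Fin n → ℝ => sg1 (psum i y) * pad y i) 2 (gv n) := by
  have hm : Measurable (fun y : Fin n → ℝ => sg1 (psum i y)) := by
    unfold sg1
    exact Measurable.ite (measurableSet_le measurable_const (psum_meas i)) measurable_const measurable_const
  refine (pad_memLp i).mono ((hm.mul (pad_meas i)).aestronglyMeasurable) ?_
  filter_upwards with y
  rw [norm_mul]
  have : ‖sg1 (psum i y)‖ = 1 := by unfold sg1; split_ifs <;> simp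
  rw [this, one_mul]

lemma doob_term_integrable {n : ℕ} (i : ℕ) :
    Integrable (fun y : Fin n → ℝ => rmax i y * (sg1 (psum i y) * pad y i)) (gv n) :=
  (rmax_memLp i).integrable_mul (sg_pad_memLp i)

lemma psum_congr {n : ℕ} {y z : Fin n → ℝ} {t : ℕ} (h : ∀ i < t, pad y i = pad z i) :
    psum t y = psum t z := by
  unfold psum
  apply Finset.sum_congr rfl; intro i hi; exact h i (Finset.mem_range.1 hi)

lemma rmax_congr {n : ℕ} {y z : Fin n → ℝ} {t : ℕ} (h : ∀ i < t, pad y i = pad z i) :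
    rmax t y = rmax t z := by
  induction t with
  | zero => rfl
  | succ t ih =>
    unfold rmax
    rw [ih (fun i hi => h i (by omega)), psum_congr h]

lemma doob_term_integral {n : ℕ} (i : ℕ) (hi : i < n) :
    ∫ y, rmax i y * (sg1 (psum i y) * pad y i) ∂gv n = 0 := by
  have hf := gv_flip (n := n) ⟨i, hi⟩
  set F : (Fin n → ℝ) → (Fin n → ℝ) := fun x k => if k = ⟨i, hi⟩ then - x k else x k with hF
  have h1 : ∫ y, rmax i y * (sg1 (psum i y) * pad y i) ∂gv n =
      ∫ y, rmax i (F y) * (sg1 (psum i (F y)) * pad (F y) i) ∂gv n := by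
    conv_lhs => rw [← hf.map_eq]
    rw [integral_map hf.measurable.aemeasurable]
    rw [hf.map_eq]; exact (doob_term_integrable i).aestronglyMeasurable
  have h2 : ∀ y : Fin n → ℝ, rmax i (F y) * (sg1 (psum i (F y)) * pad (F y) i) =
      - (rmax i y * (sg1 (psum i y) * pad y i)) := by
    intro y
    have e1 : ∀ k < i, pad (F y) k = pad y k := by
      intro k hk
      simp only [pad, hF]
      have : k < n := by omega
      simp only [this, dite_true, Fin.mk.injEq]
      rw [if_neg (by omega)]
    have e2 : pad (F y) i = - pad y i := by simp [pad, hF, hi]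
    rw [psum_congr e1, rmax_congr e1, e2]; ring
  simp_rw [h2] at h1
  rw [integral_neg] at h1
  linarith

lemma psum_eq_lin {n : ℕ} (t : ℕ) (y : Fin n → ℝ) :
    psum t y = ∑ i : Fin n, (if i.1 < t then (1 : ℝ) else 0) * y i := by
  induction t with
  | zero => simp [psum]
  | succ t ih =>
    have h1 : psum (t + 1) y = psum t y + pad y t := by unfold psum; rw [Finset.sum_range_succ]
    rw [h1, ih]
    have h2 : pad y t = ∑ i : Fin n, (if i.1 = t then (1 : ℝ) else 0) * y i := by
      unfold pad
      split_ifs with h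
      · rw [Finset.sum_eq_single ⟨t, h⟩]
        · simp
        · intro b _ hb
          rw [if_neg (fun h' => hb (Fin.ext h')), zero_mul]
        · simp
      · symm; apply Finset.sum_eq_zero; intro i _
        rw [if_neg (by omega), zero_mul]
    rw [h2, ← Finset.sum_add_distrib]
    apply Finset.sum_congr rfl; intro i _
    rw [← add_mul]
    congr 1
    split_ifs <;> first | omega | norm_num

lemma doobF_integrable {n : ℕ} : Integrable (doobF : (Fin n → ℝ) → ℝ) (gv n) := by
  unfold doobF
  apply Integrable.sub
  · exact (psum_memLp n).integrable_sq.const_mul 4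
  · apply Integrable.const_mul
    exact integrable_finsetSum _ fun i _ => doob_term_integrable i

lemma doobF_integral {n : ℕ} : ∫ y, doobF y ∂gv n = 4 * n := by
  unfold doobF
  rw [integral_sub, integral_const_mul, integral_const_mul, integral_finsetSum]
  · rw [Finset.sum_eq_zero (fun i hi => doob_term_integral i (Finset.mem_range.1 hi))]
    simp_rw [psum_eq_lin]
    rw [lin_sq_integral]
    simp
  · exact fun i _ => doob_term_integrable i
  · exact (psum_memLp n).integrable_sq.const_mul 4
  · apply Integrable.const_mul
    exact integrable_finsetSum _ fun i _ => doob_term_integrable i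

lemma extZ_neg {n : ℕ} (θ : Fin n → ℝ) {t : ℤ} (h : t < 0) : extZ θ t = 0 := by
  unfold extZ; rw [if_neg (by omega)]

lemma extZ_ge {n : ℕ} (θ : Fin n → ℝ) {t : ℤ} (h : (n : ℤ) ≤ t) : extZ θ t = 0 := by
  unfold extZ pad
  rw [if_pos (by omega), dif_neg (by omega)]

lemma bd_inj (r : ℕ) (f : ℤ → ℝ) (h0 : ∀ t < 0, f t = 0) (h : ∀ t, (bdL ^ r) f t = 0) :
    ∀ t, f t = 0 := by
  induction r generalizing f with
  | zero => simpa using h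
  | succ r ih =>
    have h1 := ih (bdL f) (by
      intro t ht; rw [bdL_apply, h0 t ht, h0 (t - 1) (by omega), sub_zero]) (by
      intro t; rw [← bd_succ]; exact h t)
    intro t
    by_cases ht : t < 0
    · exact h0 t ht
    · obtain ⟨m, rfl⟩ := Int.eq_ofNat_of_zero_le (not_lt.1 ht)
      clear ht
      induction m with
      | zero =>
        have := h1 0
        rw [bdL_apply, h0 (0 - 1) (by norm_num)] at this
        simpa using this
      | succ m ihm =>
        have := h1 ((m + 1 : ℕ) : ℤ)
        rw [bdL_apply] at this
        push_cast at this
        rw [add_sub_cancel_right, ihm, sub_zero] at this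
        push_cast; exact this

lemma linalg (r ℓ : ℕ) (hrl : r ≤ ℓ) : ∃ u : Fin r → Fin ℓ → ℝ,
    (∀ j k, ∑ i, u j i * u k i = if j = k then 1 else 0) ∧
    ∀ y : Fin ℓ → ℝ, ∃ w : ℤ → ℝ, (∀ t < 0, w t = 0) ∧ (∀ t, ((ℓ - r : ℕ) : ℤ) ≤ t → w t = 0) ∧
      ∀ i : Fin ℓ, y i - ∑ j, (∑ k, u j k * y k) * u j i = (bdL ^ r) w i.1 := by
  let B : (Fin (ℓ - r) → ℝ) →ₗ[ℝ] EuclideanSpace ℝ (Fin ℓ) :=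
    { toFun := fun z => WithLp.toLp 2 (fun i : Fin ℓ => (bdL ^ r) (extZ z) i.1)
      map_add' := by
        intro a b
        have e := extZ_add_smul a b 1
        rw [one_smul, one_smul] at e
        rw [e]; ext i; simp
      map_smul' := by
        intro c a
        have e := extZ_add_smul 0 a c
        have e0 : extZ (0 : Fin (ℓ - r) → ℝ) = 0 := by ext t; simp [extZ, pad]
        rw [zero_add, e0, zero_add] at e
        rw [e]; ext i; simp }
  have hB : ∀ z i, B z i = (bdL ^ r) (extZ z) i.1 := fun z i => rfl
  have hinj : Function.Injective B := by
    rw [← LinearMap.ker_eq_bot, LinearMap.ker_eq_bot']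
    intro z hz
    have h1 : ∀ t, (bdL ^ r) (extZ z) t = 0 := by
      intro t
      by_cases h0 : t < 0
      · apply bd_zero_of_interval; intro s _ hs; exact extZ_neg z (by omega)
      by_cases h1 : (ℓ : ℤ) ≤ t
      · apply bd_zero_of_interval; intro s hs _; exact extZ_ge z (by omega)
      · obtain ⟨m, rfl⟩ := Int.eq_ofNat_of_zero_le (not_lt.1 h0)
        have := hB z ⟨m, by omega⟩
        rw [hz] at this
        exact this.symm
    have h2 := bd_inj r (extZ z) (fun t ht => extZ_neg z ht) h1
    funext i
    rw [← extZ_fin z i, h2]; rfl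
  let R := LinearMap.range B
  have hR : Module.finrank ℝ R = ℓ - r := by
    rw [LinearMap.finrank_range_of_inj hinj]; simp
  have hRo : Module.finrank ℝ Rᗮ = r := by
    apply Submodule.finrank_add_finrank_orthogonal'
    rw [hR]; simp; omega
  let b := (stdOrthonormalBasis ℝ Rᗮ).reindex (finCongr hRo)
  have hin : ∀ x y : EuclideanSpace ℝ (Fin ℓ), inner ℝ x y = ∑ i, x i * y i := by
    intro x y
    rw [PiLp.inner_apply]
    apply Finset.sum_congr rfl; intro i _
    simp [mul_comm]
  refine ⟨fun j i => (b j : EuclideanSpace ℝ (Fin ℓ)) i, ?_, ?_⟩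
  · intro j k
    rw [← hin, ← Submodule.coe_inner]
    exact orthonormal_iff_ite.1 b.orthonormal j k
  · intro y
    set Y : EuclideanSpace ℝ (Fin ℓ) := WithLp.toLp 2 y with hY
    have h1 : Y - Rᗮ.starProjection Y ∈ Rᗮᗮ := Submodule.sub_starProjection_mem_orthogonal Y
    rw [Submodule.orthogonal_orthogonal] at h1
    obtain ⟨z, hz⟩ := h1
    refine ⟨extZ z, fun t ht => extZ_neg z ht, fun t ht => extZ_ge z ht, ?_⟩
    intro i
    rw [← hB, hz, b.starProjection_eq_sum_rankOne]
    simp only [hin, hY, PiLp.sub_apply, sum_apply, InnerProductSpace.rankOne_apply]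
    congr 1
    rw [WithLp.ofLp_sum, Finset.sum_apply]
    rfl

/-- iterated summation bound -/
lemma bd_sup (q ℓ : ℕ) (w : ℤ → ℝ) (h0 : ∀ t < 0, w t = 0) (h1 : ∀ t, (ℓ : ℤ) ≤ t + q → w t = 0)
    (B : ℝ) (hB : ∀ t, |(bdL ^ q) w t| ≤ B) : ∀ t, |w t| ≤ ℓ ^ q * B := by
  induction q generalizing w with
  | zero => simpa using hB
  | succ q ih =>
    have hB0 : 0 ≤ B := (abs_nonneg _).trans (hB 0)
    have h2 := ih (bdL w) (by
      intro t ht; rw [bdL_apply, h0 t ht, h0 (t - 1) (by omega), sub_zero]) (by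
      intro t ht; rw [bdL_apply, h1 t (by push_cast; omega), h1 (t - 1) (by push_cast; omega), sub_zero]) (by
      intro t; rw [← bd_succ]; exact hB t)
    have h3 : ∀ m : ℕ, |w m| ≤ (m + 1) * (ℓ ^ q * B) := by
      intro m
      induction m with
      | zero =>
        have := h2 0
        rw [bdL_apply, h0 (0 - 1) (by norm_num)] at this
        simpa using this
      | succ m ihm =>
        have := h2 ((m + 1 : ℕ) : ℤ)
        rw [bdL_apply] at this
        push_cast at this ⊢
        rw [add_sub_cancel_right] at this
        have h4 := abs_add_le (w (m + 1) - w m) (w m)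
        rw [sub_add_cancel] at h4
        linarith
    intro t
    by_cases ht : t < 0
    · rw [h0 t ht, abs_zero]; positivity
    by_cases ht2 : (ℓ : ℤ) ≤ t + ((q + 1 : ℕ) : ℤ)
    · rw [h1 t ht2, abs_zero]; positivity
    obtain ⟨m, rfl⟩ := Int.eq_ofNat_of_zero_le (not_lt.1 ht)
    refine (h3 m).trans ?_
    have : (m : ℝ) + 1 ≤ ℓ := by
      have : m + 1 ≤ ℓ := by push_cast at ht2; omega
      exact_mod_cast this
    rw [pow_succ]
    have h5 : 0 ≤ (ℓ : ℝ) ^ q * B := by positivity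
    nlinarith

lemma bd_partial (q : ℕ) (w : ℤ → ℝ) (h0 : ∀ t < 0, w t = 0) (t : ℕ) :
    (bdL ^ q) w t = ∑ i ∈ Finset.range (t + 1), (bdL ^ (q + 1)) w i := by
  have hz : (bdL ^ q) w (-1) = 0 := by
    apply bd_zero_of_interval; intro s _ hs; exact h0 s (by omega)
  induction t with
  | zero =>
    rw [bd_succ']; simp [bdL_apply, hz]
  | succ t ih =>
    rw [Finset.sum_range_succ, ← ih, bd_succ', bdL_apply]
    push_cast
    rw [add_sub_cancel_right]; ring

lemma bd_shift (r : ℕ) (w : ℤ → ℝ) (s t : ℤ) :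
    (bdL ^ r) (fun a => w (a - s)) t = (bdL ^ r) w (t - s) := by
  induction r generalizing t with
  | zero => rfl
  | succ r ih =>
    rw [bd_succ', bd_succ', bdL_apply, bdL_apply, ih, ih]
    rw [sub_right_comm t 1 s]

lemma on_sq {r ℓ : ℕ} (u : Fin r → Fin ℓ → ℝ)
    (hu : ∀ j k, ∑ i, u j i * u k i = if j = k then 1 else 0) (c : Fin r → ℝ) :
    ∑ i, (∑ j, c j * u j i) ^ 2 = ∑ j, c j ^ 2 := by
  have h1 : ∀ i, (∑ j, c j * u j i) ^ 2 = ∑ j, ∑ k, c j * c k * (u j i * u k i) := by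
    intro i
    rw [sq, Finset.sum_mul_sum]
    refine Finset.sum_congr rfl fun j _ => Finset.sum_congr rfl fun k _ => ?_
    ring
  simp_rw [h1]
  rw [Finset.sum_comm]
  refine Finset.sum_congr rfl fun j _ => ?_
  rw [Finset.sum_comm]
  simp_rw [← Finset.mul_sum, hu]
  simp [sq]

lemma on_pyth {r ℓ : ℕ} (u : Fin r → Fin ℓ → ℝ)
    (hu : ∀ j k, ∑ i, u j i * u k i = if j = k then 1 else 0) (z : Fin ℓ → ℝ) :
    ∑ i, (z i - ∑ j, (∑ k, u j k * z k) * u j i) ^ 2 = ∑ i, z i ^ 2 - ∑ j, (∑ k, u j k * z k) ^ 2 := by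
  have h1 := on_sq u hu (fun j => ∑ k, u j k * z k)
  have h2 : ∑ i, z i * ∑ j, (∑ k, u j k * z k) * u j i = ∑ j, (∑ k, u j k * z k) ^ 2 := by
    simp_rw [Finset.mul_sum]
    rw [Finset.sum_comm]
    refine Finset.sum_congr rfl fun j _ => ?_
    rw [sq]
    conv_rhs => rw [Finset.mul_sum]
    refine Finset.sum_congr rfl fun i _ => ?_
    ring
  have h3 : ∀ i, (z i - ∑ j, (∑ k, u j k * z k) * u j i) ^ 2 = z i ^ 2 -
      2 * (z i * ∑ j, (∑ k, u j k * z k) * u j i) + (∑ j, (∑ k, u j k * z k) * u j i) ^ 2 := by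
    intro i; ring
  simp_rw [h3]
  rw [Finset.sum_add_distrib, Finset.sum_sub_distrib, ← Finset.mul_sum, h2, h1]
  ring

/-- coefficient vector of the partial sums of the residual -/
def gvec {r ℓ : ℕ} (u : Fin r → Fin ℓ → ℝ) (t : Fin ℓ) (i : Fin ℓ) : ℝ :=
  (if i.1 < t.1 + 1 then 1 else 0) - ∑ j, (∑ k, u j k * (if k.1 < t.1 + 1 then 1 else 0)) * u j i

lemma ind_sq {ℓ : ℕ} (t : ℕ) : ∑ i : Fin ℓ, (if i.1 < t then (1:ℝ) else 0) ^ 2 ≤ ℓ := by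
  calc _ ≤ ∑ i : Fin ℓ, (1:ℝ) := Finset.sum_le_sum fun i _ => by split_ifs <;> norm_num
    _ = ℓ := by simp

lemma gvec_sq {r ℓ : ℕ} (u : Fin r → Fin ℓ → ℝ)
    (hu : ∀ j k, ∑ i, u j i * u k i = if j = k then 1 else 0) (t : Fin ℓ) :
    ∑ i, gvec u t i ^ 2 ≤ ℓ := by
  have := on_pyth u hu (fun i => if i.1 < t.1 + 1 then 1 else 0)
  unfold gvec
  rw [this]
  have h2 : 0 ≤ ∑ j, (∑ k, u j k * (if k.1 < t.1 + 1 then 1 else 0)) ^ 2 := by positivity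
  have := ind_sq (ℓ := ℓ) (t.1 + 1)
  linarith

lemma gvec_lin {r ℓ : ℕ} (u : Fin r → Fin ℓ → ℝ) (t : Fin ℓ) (y : Fin ℓ → ℝ) :
    ∑ i, gvec u t i * y i = psum (t.1 + 1) y -
      ∑ j, (∑ k, u j k * y k) * (∑ k, u j k * (if k.1 < t.1 + 1 then 1 else 0)) := by
  rw [psum_eq_lin]
  unfold gvec
  simp_rw [sub_mul]
  rw [Finset.sum_sub_distrib]
  congr 1
  simp_rw [Finset.sum_mul _ _ (y _)]
  rw [Finset.sum_comm]
  refine Finset.sum_congr rfl fun j _ => ?_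
  rw [mul_comm (∑ k, u j k * y k), Finset.mul_sum]
  refine Finset.sum_congr rfl fun i _ => ?_
  ring

lemma gvec_lin' {r ℓ : ℕ} (u : Fin r → Fin ℓ → ℝ) (t : Fin ℓ) (y : Fin ℓ → ℝ) :
    ∑ i, gvec u t i * y i = psum (t.1 + 1) (fun i => y i - ∑ j, (∑ k, u j k * y k) * u j i) := by
  rw [gvec_lin, psum_eq_lin, psum_eq_lin]
  simp_rw [mul_sub]
  rw [Finset.sum_sub_distrib]
  congr 1
  simp_rw [Finset.mul_sum]
  rw [Finset.sum_comm]
  refine Finset.sum_congr rfl fun i _ => Finset.sum_congr rfl fun j _ => ?_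
  ring

lemma gvec_bound {r ℓ : ℕ} (u : Fin r → Fin ℓ → ℝ)
    (hu : ∀ j k, ∑ i, u j i * u k i = if j = k then 1 else 0) (t : Fin ℓ) (y : Fin ℓ → ℝ) :
    (∑ i, gvec u t i * y i) ^ 2 ≤ 2 * doobF y + 2 * ℓ * ∑ j, (∑ k, u j k * y k) ^ 2 := by
  rw [gvec_lin]
  have h1 := doob_bound y (t := t.1 + 1) t.2
  have h2 := Finset.sum_mul_sq_le_sq_mul_sq Finset.univ (fun j => ∑ k, u j k * y k)
    (fun j => ∑ k, u j k * (if k.1 < t.1 + 1 then (1:ℝ) else 0))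
  have h3 := on_pyth u hu (fun i => if i.1 < t.1 + 1 then 1 else 0)
  have h4 : 0 ≤ ∑ i, ((if i.1 < t.1 + 1 then (1:ℝ) else 0) - ∑ j, (∑ k, u j k * (if k.1 < t.1 + 1 then 1 else 0)) * u j i) ^ 2 := by positivity
  have h5 := ind_sq (ℓ := ℓ) (t.1 + 1)
  set A := ∑ j, (∑ k, u j k * y k) * (∑ k, u j k * (if k.1 < t.1 + 1 then 1 else 0))
  set P := psum (t.1 + 1) y
  have h6 : A ^ 2 ≤ (∑ j, (∑ k, u j k * y k) ^ 2) * ℓ := by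
    refine h2.trans (mul_le_mul_of_nonneg_left ?_ (by positivity))
    linarith
  nlinarith [sq_nonneg (P + A)]

/-- exponential domination of the exceptional part -/
def excF {r ℓ : ℕ} (u : Fin r → Fin ℓ → ℝ) (T lam : ℝ) (y : Fin ℓ → ℝ) : ℝ :=
  ∑ t : Fin ℓ, ∑ i : Fin ℓ, ∑ a ∈ ({1, -1} : Finset ℝ), ∑ b ∈ ({1, -1} : Finset ℝ),
    Real.exp (-(T ^ 2 / 2)) * Real.exp (∑ q, (a * lam * gvec u t q + b * (if q = i then 1 else 0)) * y q)

lemma excF_eq {r ℓ : ℕ} (u : Fin r → Fin ℓ → ℝ) (lam a b : ℝ) (t i : Fin ℓ) (y : Fin ℓ → ℝ) :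
    ∑ q, (a * lam * gvec u t q + b * (if q = i then 1 else 0)) * y q =
      a * (lam * ∑ q, gvec u t q * y q) + b * y i := by
  simp_rw [add_mul]
  rw [Finset.sum_add_distrib]
  congr 1
  · rw [Finset.mul_sum, Finset.mul_sum]
    refine Finset.sum_congr rfl fun j _ => ?_
    ring
  · simp

lemma sq_le_exp (x : ℝ) : x ^ 2 ≤ 2 * (Real.exp x + Real.exp (-x)) := by
  have h1 : ∀ z : ℝ, 0 ≤ z → z ^ 2 ≤ 2 * (Real.exp z + Real.exp (-z)) := by
    intro z hz
    have h := Real.quadratic_le_exp_of_nonneg hz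
    have h3 := Real.exp_pos (-z)
    nlinarith
  rcases le_total 0 x with h | h
  · exact h1 x h
  · have := h1 (-x) (by linarith)
    rw [neg_sq, neg_neg] at this; linarith

lemma excF_nonneg {r ℓ : ℕ} (u : Fin r → Fin ℓ → ℝ) (T lam : ℝ) (y : Fin ℓ → ℝ) :
    0 ≤ excF u T lam y := by unfold excF; positivity

lemma excF_ge {r ℓ : ℕ} (u : Fin r → Fin ℓ → ℝ) (T lam : ℝ) (hl : 0 ≤ lam) (y : Fin ℓ → ℝ) (t : Fin ℓ)
    (h : T ^ 2 / 2 ≤ lam * |∑ q, gvec u t q * y q|) : ∑ i, y i ^ 2 ≤ 2 * excF u T lam y := by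
  unfold excF
  have h1 := Finset.single_le_sum (f := fun t : Fin ℓ => ∑ i : Fin ℓ, ∑ a ∈ ({1, -1} : Finset ℝ), ∑ b ∈ ({1, -1} : Finset ℝ),
    Real.exp (-(T ^ 2 / 2)) * Real.exp (∑ q, (a * lam * gvec u t q + b * (if q = i then 1 else 0)) * y q))
    (fun i _ => by positivity) (Finset.mem_univ t)
  refine le_trans ?_ (mul_le_mul_of_nonneg_left h1 (by norm_num))
  rw [Finset.mul_sum]
  refine Finset.sum_le_sum fun i _ => ?_
  have hne : (1:ℝ) ∉ ({-1} : Finset ℝ) := by norm_num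
  have h2 : ∃ a ∈ ({1, -1} : Finset ℝ), T ^ 2 / 2 ≤ a * (lam * ∑ q, gvec u t q * y q) := by
    rcases abs_cases (∑ q, gvec u t q * y q) with ⟨h3, _⟩ | ⟨h3, _⟩
    · exact ⟨1, by simp, by rw [h3] at h; linarith⟩
    · exact ⟨-1, by simp, by rw [h3] at h; linarith⟩
  obtain ⟨a, ha, h2⟩ := h2
  have h3 := Finset.single_le_sum (f := fun a : ℝ => ∑ b ∈ ({1, -1} : Finset ℝ),
    Real.exp (-(T ^ 2 / 2)) * Real.exp (∑ q, (a * lam * gvec u t q + b * (if q = i then 1 else 0)) * y q))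
    (fun i _ => by positivity) ha
  refine le_trans ?_ (mul_le_mul_of_nonneg_left h3 (by norm_num))
  have h4 : ∀ b, Real.exp (b * y i) ≤ Real.exp (-(T ^ 2 / 2)) * Real.exp (∑ q, (a * lam * gvec u t q + b * (if q = i then 1 else 0)) * y q) := by
    intro b
    rw [excF_eq, ← Real.exp_add]
    apply Real.exp_le_exp.2; linarith
  rw [Finset.sum_insert hne, Finset.sum_singleton]
  have h5 := h4 1
  have h6 := h4 (-1)
  rw [one_mul] at h5
  rw [neg_one_mul] at h6
  have := sq_le_exp (y i)
  linarith

lemma excF_integrable {r ℓ : ℕ} (u : Fin r → Fin ℓ → ℝ) (T lam : ℝ) :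
    Integrable (excF u T lam) (gv ℓ) := by
  unfold excF
  refine integrable_finsetSum _ fun t _ => integrable_finsetSum _ fun i _ =>
    integrable_finsetSum _ fun a _ => integrable_finsetSum _ fun b _ => ?_
  exact (exp_lin_integrable _).const_mul _

lemma excF_integral {r ℓ : ℕ} (u : Fin r → Fin ℓ → ℝ)
    (hu : ∀ j k, ∑ i, u j i * u k i = if j = k then 1 else 0) (T lam : ℝ) (hl : lam ^ 2 * ℓ ≤ T ^ 2 / 4) :
    ∫ y, excF u T lam y ∂gv ℓ ≤ 4 * ℓ ^ 2 * Real.exp (1 - T ^ 2 / 4) := by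
  unfold excF
  have hi : ∀ (t i : Fin ℓ) (a b : ℝ), Integrable (fun y : Fin ℓ → ℝ => Real.exp (-(T ^ 2 / 2)) * Real.exp (∑ q, (a * lam * gvec u t q + b * (if q = i then 1 else 0)) * y q)) (gv ℓ) :=
    fun t i a b => (exp_lin_integrable _).const_mul _
  rw [integral_finsetSum _ fun t _ => integrable_finsetSum _ fun i _ =>
    integrable_finsetSum _ fun a _ => integrable_finsetSum _ fun b _ => hi t i a b]
  have key : ∀ t i : Fin ℓ, ∀ a ∈ ({1, -1} : Finset ℝ), ∀ b ∈ ({1, -1} : Finset ℝ),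
      ∫ y, Real.exp (-(T ^ 2 / 2)) * Real.exp (∑ q, (a * lam * gvec u t q + b * (if q = i then 1 else 0)) * y q) ∂gv ℓ ≤
        Real.exp (1 - T ^ 2 / 4) := by
    intro t i a ha b hb
    rw [integral_const_mul, exp_lin_integral, ← Real.exp_add]
    apply Real.exp_le_exp.2
    have ha2 : a ^ 2 = 1 := by
      simp only [Finset.mem_insert, Finset.mem_singleton] at ha; rcases ha with rfl | rfl <;> norm_num
    have hb2 : b ^ 2 = 1 := by
      simp only [Finset.mem_insert, Finset.mem_singleton] at hb; rcases hb with rfl | rfl <;> norm_num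
    have h1 : ∑ q, (a * lam * gvec u t q + b * (if q = i then 1 else 0)) ^ 2 ≤
        ∑ q, (2 * lam ^ 2 * gvec u t q ^ 2 + 2 * (if q = i then 1 else 0)) := by
      refine Finset.sum_le_sum fun q _ => ?_
      have e : (if q = i then (1:ℝ) else 0) ^ 2 = if q = i then 1 else 0 := by split_ifs <;> norm_num
      set z := (if q = i then (1:ℝ) else 0)
      have : (a * lam * gvec u t q + b * z) ^ 2 + (a * lam * gvec u t q - b * z) ^ 2
        = 2 * lam ^ 2 * gvec u t q ^ 2 * a ^ 2 + 2 * z ^ 2 * b ^ 2 := by ring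
      rw [ha2, hb2, e] at this
      nlinarith [sq_nonneg (a * lam * gvec u t q - b * z)]
    rw [Finset.sum_add_distrib, ← Finset.mul_sum, ← Finset.mul_sum] at h1
    simp only [Finset.sum_ite_eq', Finset.mem_univ, if_true] at h1
    have := gvec_sq u hu t
    have := mul_le_mul_of_nonneg_left this (sq_nonneg lam)
    nlinarith
  calc _ ≤ ∑ t : Fin ℓ, (4 * ℓ * Real.exp (1 - T ^ 2 / 4)) := by
        refine Finset.sum_le_sum fun t _ => ?_
        rw [integral_finsetSum _ fun i _ =>
          integrable_finsetSum _ fun a _ => integrable_finsetSum _ fun b _ => hi t i a b]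
        calc _ ≤ ∑ i : Fin ℓ, (4 * Real.exp (1 - T ^ 2 / 4)) := by
              refine Finset.sum_le_sum fun i _ => ?_
              rw [integral_finsetSum _ fun a _ => integrable_finsetSum _ fun b _ => hi t i a b]
              have : (∑ a ∈ ({1, -1} : Finset ℝ), ∑ b ∈ ({1, -1} : Finset ℝ), Real.exp (1 - T ^ 2 / 4)) = 4 * Real.exp (1 - T ^ 2 / 4) := by
                have : ({1, -1} : Finset ℝ).card = 2 := by rw [Finset.card_pair]; norm_num
                simp only [Finset.sum_const, this]; norm_num; ring
              rw [← this]
              refine Finset.sum_le_sum fun a ha => ?_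
              rw [integral_finsetSum _ fun b _ => hi t i a b]
              exact Finset.sum_le_sum fun b hb => key t i a ha b hb
          _ = _ := by simp; ring
    _ = _ := by simp; ring

set_option maxHeartbeats 1000000 in
lemma cellA (r ℓ : ℕ) (hr : 1 ≤ r) (hrl : r ≤ ℓ) (m : ℝ) (hm : (ℓ : ℝ) ≤ m) :
    ∃ Y : (Fin ℓ → ℝ) → ℝ, Integrable Y (gv ℓ) ∧ ∫ y, Y y ∂gv ℓ ≤ 16 + 3 * r ∧
    ∀ y : Fin ℓ → ℝ, ∃ (p w : ℤ → ℝ) (b : ℝ), 0 ≤ b ∧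
      b ^ 2 ≤ 16 * (ℓ : ℝ) ^ (2 * (r : ℤ) - 1) * Real.log (Real.exp 1 * m) ∧
      (∀ t, ¬ (0 ≤ t ∧ t < (ℓ : ℤ)) → p t = 0) ∧ (∀ t, ¬ (0 ≤ t ∧ t < (ℓ : ℤ)) → w t = 0) ∧
      (∀ t, |w t| ≤ b) ∧ (∀ i : Fin ℓ, y i = p i.1 + (-1) ^ r * (bdL ^ r) w i.1) ∧
      (∀ t, ¬ (0 ≤ t ∧ t < (ℓ : ℤ)) → (bdL ^ r) w t = 0) ∧
      ∑ i ∈ Finset.range ℓ, p i ^ 2 + b ^ 2 * (ℓ : ℝ) ^ (1 - 2 * (r : ℤ)) ≤ Y y := by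
  obtain ⟨u, hu, hw⟩ := linalg r ℓ hrl
  have hℓ : (1:ℝ) ≤ ℓ := by exact_mod_cast hr.trans hrl
  have hm1 : 1 ≤ m := hℓ.trans hm
  have hlog : 1 ≤ Real.log (Real.exp 1 * m) := by
    rw [Real.log_mul (Real.exp_pos 1).ne' (by linarith), Real.log_exp]
    have := Real.log_nonneg hm1; linarith
  set T := Real.sqrt (16 * Real.log (Real.exp 1 * m)) with hT
  have hT2 : T ^ 2 = 16 * Real.log (Real.exp 1 * m) := Real.sq_sqrt (by linarith)
  have hT0 : 0 ≤ T := Real.sqrt_nonneg _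
  set sq := Real.sqrt (ℓ : ℝ) with hsq
  have hs2 : sq ^ 2 = ℓ := Real.sq_sqrt (by linarith)
  have hs0 : 0 < sq := Real.sqrt_pos.2 (by linarith)
  set lam := T / (2 * sq) with hlam
  have hlam0 : 0 ≤ lam := by positivity
  have hlam2 : lam ^ 2 * ℓ = T ^ 2 / 4 := by
    rw [hlam, ← hs2]; field_simp; ring
  have hQi : Integrable (fun y : Fin ℓ → ℝ => ∑ j, (∑ k, u j k * y k) ^ 2) (gv ℓ) :=
    integrable_finsetSum _ fun j _ => lin_sq_integrable _
  have hQ : ∫ y : Fin ℓ → ℝ, ∑ j, (∑ k, u j k * y k) ^ 2 ∂gv ℓ = r := by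
    rw [integral_finsetSum _ fun j _ => lin_sq_integrable _]
    simp_rw [lin_sq_integral]
    have : ∀ j, ∑ i, u j i ^ 2 = 1 := by
      intro j; have := hu j j; simp only [if_true] at this; simpa [pow_two] using this
    simp [this]
  have hD : ∫ y : Fin ℓ → ℝ, doobF y ∂gv ℓ = 4 * ℓ := doobF_integral
  have hDi : Integrable (fun y : Fin ℓ → ℝ => doobF y) (gv ℓ) := doobF_integrable
  have hE : ∫ y, excF u T lam y ∂gv ℓ ≤ 4 := by
    refine (excF_integral u hu T lam hlam2.le).trans ?_
    have : Real.exp (1 - T ^ 2 / 4) = Real.exp 1 * ((Real.exp 1 * m) ^ 4)⁻¹ := by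
      rw [hT2, sub_eq_add_neg, Real.exp_add]
      congr 1
      rw [Real.exp_neg]
      congr 1
      rw [show 16 * Real.log (Real.exp 1 * m) / 4 = ((4:ℕ):ℝ) * Real.log (Real.exp 1 * m) by push_cast; ring,
        ← Real.log_pow, Real.exp_log (by positivity)]
    rw [this]
    have he : 1 ≤ Real.exp 1 := Real.one_le_exp (by norm_num)
    rw [← div_eq_mul_inv, mul_div_assoc', div_le_iff₀ (by positivity)]
    have h1 : (ℓ:ℝ) ^ 2 ≤ m ^ 4 := by
      calc (ℓ:ℝ) ^ 2 ≤ m ^ 2 := by gcongr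
        _ ≤ m ^ 4 := pow_le_pow_right₀ hm1 (by norm_num)
    have h2 : Real.exp 1 ≤ Real.exp 1 ^ 4 := le_self_pow₀ he (by norm_num)
    rw [mul_pow]
    calc 4 * (ℓ:ℝ) ^ 2 * Real.exp 1 ≤ 4 * m ^ 4 * Real.exp 1 ^ 4 := by gcongr
      _ = _ := by ring
  refine ⟨fun y => 2 * excF u T lam y + (3 * ∑ j, (∑ k, u j k * y k) ^ 2 + 2 * (ℓ:ℝ)⁻¹ * doobF y), ?_, ?_, ?_⟩
  · exact ((excF_integrable u T lam).const_mul 2).add ((hQi.const_mul 3).add (hDi.const_mul _))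
  · have e1 : Integrable (fun y => 2 * excF u T lam y) (gv ℓ) := (excF_integrable u T lam).const_mul 2
    have e2 := hQi.const_mul 3
    have e3 := hDi.const_mul (2 * (ℓ:ℝ)⁻¹)
    have s1 := integral_add e1 (e2.add e3)
    simp only [Pi.add_apply] at s1
    beta_reduce
    rw [s1, integral_add e2 e3, integral_const_mul, integral_const_mul,
      integral_const_mul, hQ, hD]
    have : 2 * (ℓ:ℝ)⁻¹ * (4 * ℓ) = 8 := by field_simp; ring
    linarith
  · intro y
    have hE0 := excF_nonneg u T lam y
    have hD0 : 0 ≤ doobF y := (sq_nonneg _).trans (doob_bound y (t := 0) (by omega))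
    have hQ0 : 0 ≤ ∑ j, (∑ k, u j k * y k) ^ 2 := by positivity
    by_cases hx : ∃ t : Fin ℓ, T * sq < |∑ q, gvec u t q * y q|
    · obtain ⟨t, ht⟩ := hx
      refine ⟨extZ y, 0, 0, le_rfl, by rw [zero_pow (by norm_num)]; have := zero_le_one.trans hlog; positivity, ?_, by simp, by simp, ?_, by simp, ?_⟩
      · intro t ht
        by_cases h : t < 0
        · exact extZ_neg y h
        · exact extZ_ge y (by omega)
      · intro i; simp [extZ_fin]
      · have := excF_ge u T lam hlam0 y t (by
          calc T ^ 2 / 2 = lam * (T * sq) := by rw [hlam]; field_simp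
            _ ≤ _ := by gcongr)
        rw [Finset.sum_range]
        simp only [extZ_fin]
        have : 0 ≤ 2 * (ℓ:ℝ)⁻¹ * doobF y := by positivity
        simp only [ne_eq, OfNat.ofNat_ne_zero, not_false_eq_true, zero_pow, zero_mul, add_zero]
        linarith
    · push Not at hx
      obtain ⟨w', hw0, hw1, hwe⟩ := hw y
      set S := Finset.univ.sup' (⟨⟨0, by omega⟩, Finset.mem_univ _⟩ : (Finset.univ : Finset (Fin ℓ)).Nonempty)
        (fun t : Fin ℓ => |∑ q, gvec u t q * y q|) with hS
      obtain ⟨t0, _, ht0⟩ := Finset.exists_mem_eq_sup' (⟨⟨0, by omega⟩, Finset.mem_univ _⟩ : (Finset.univ : Finset (Fin ℓ)).Nonempty)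
        (fun t : Fin ℓ => |∑ q, gvec u t q * y q|)
      rw [← hS] at ht0
      have hle : ∀ t, |∑ q, gvec u t q * y q| ≤ S := fun t => Finset.le_sup' (fun t : Fin ℓ => |∑ q, gvec u t q * y q|) (Finset.mem_univ t)
      have hS0 : 0 ≤ S := (abs_nonneg _).trans (hle t0)
      have hS2 : S ^ 2 ≤ 2 * doobF y + 2 * ℓ * ∑ j, (∑ k, u j k * y k) ^ 2 := by
        rw [ht0, sq_abs]; exact gvec_bound u hu t0 y
      have hST : S ^ 2 ≤ T ^ 2 * ℓ := by
        rw [← hs2, ← mul_pow]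
        apply pow_le_pow_left₀ hS0
        rw [ht0]; exact hx t0
      have hout : ∀ q ≤ r, ∀ t, ¬ (0 ≤ t ∧ t < (ℓ : ℤ)) → (bdL ^ q) w' t = 0 := by
        intro q hq t ht
        apply bd_zero_of_interval
        intro s hs1 hs2
        by_cases h : t < 0
        · exact hw0 s (by omega)
        · exact hw1 s (by omega)
      obtain ⟨q, rfl⟩ : ∃ q, r = q + 1 := ⟨r - 1, by omega⟩
      have hF : ∀ t, |(bdL ^ q) w' t| ≤ S := by
        intro t
        by_cases ht : 0 ≤ t ∧ t < (ℓ : ℤ)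
        · obtain ⟨a, rfl⟩ := Int.eq_ofNat_of_zero_le ht.1
          have ha : a < ℓ := by omega
          refine le_trans (le_of_eq ?_) (hle ⟨a, ha⟩)
          rw [gvec_lin', bd_partial q w' hw0]
          unfold psum
          congr 1
          refine Finset.sum_congr rfl fun i hi => ?_
          have hi' : i < ℓ := by have := Finset.mem_range.1 hi; omega
          unfold pad
          rw [dif_pos hi']; exact (hwe ⟨i, hi'⟩).symm
        · rw [hout q (by omega) t ht, abs_zero]; exact hS0
      have hws : ∀ t, |w' t| ≤ ℓ ^ q * S := bd_sup q ℓ w' hw0 (fun t ht => hw1 t (by omega)) S hF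
      have hsg : ((-1:ℝ)) ^ (q+1) * (-1) ^ (q+1) = 1 := by rw [← mul_pow]; norm_num
      have hbd : ∀ t, (-1 : ℝ) ^ (q+1) * (bdL ^ (q+1)) ((-1 : ℝ) ^ (q+1) • w') t = (bdL ^ (q+1)) w' t := by
        intro t
        rw [map_smul, Pi.smul_apply, smul_eq_mul, ← mul_assoc, hsg, one_mul]
      have hl0 : (ℓ:ℝ) ≠ 0 := by linarith
      refine ⟨extZ (fun i => ∑ j, (∑ k, u j k * y k) * u j i), (-1 : ℝ) ^ (q+1) • w', ℓ ^ q * S, by positivity, ?_, ?_, ?_, ?_, ?_, ?_, ?_⟩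
      · have : 2 * ((q+1 : ℕ) : ℤ) - 1 = ((2 * q + 1 : ℕ) : ℤ) := by push_cast; ring
        rw [this, zpow_natCast]
        calc ((ℓ:ℝ) ^ q * S) ^ 2 = ℓ ^ (2 * q) * S ^ 2 := by ring
          _ ≤ ℓ ^ (2 * q) * (T ^ 2 * ℓ) := by gcongr
          _ = _ := by rw [hT2]; ring
      · intro t ht
        by_cases h : t < 0
        · exact extZ_neg _ h
        · exact extZ_ge _ (by omega)
      · intro t ht
        have := hout 0 (by omega) t ht
        rw [pow_zero] at this
        have : w' t = 0 := this
        simp [this]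
      · intro t
        rw [Pi.smul_apply, smul_eq_mul, abs_mul, abs_pow, abs_neg, abs_one, one_pow, one_mul]
        exact hws t
      · intro i
        rw [hbd, ← hwe, extZ_fin]; ring
      · intro t ht
        rw [map_smul, Pi.smul_apply, hout (q+1) le_rfl t ht, smul_zero]
      · rw [Finset.sum_range]
        simp only [extZ_fin]
        rw [on_sq u hu]
        have : (1 - 2 * ((q+1 : ℕ) : ℤ)) = -((2 * q + 1 : ℕ) : ℤ) := by push_cast; ring
        rw [this, zpow_neg, zpow_natCast]
        have e : ((ℓ:ℝ) ^ q * S) ^ 2 * ((ℓ:ℝ) ^ (2 * q + 1))⁻¹ = (ℓ:ℝ)⁻¹ * S ^ 2 := by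
          rw [pow_succ (ℓ:ℝ) (2 * q), pow_mul', mul_pow]; field_simp
        rw [e]
        have := mul_le_mul_of_nonneg_left hS2 (inv_nonneg.2 (le_trans zero_le_one hℓ))
        have e2 : (ℓ:ℝ)⁻¹ * (2 * doobF y + 2 * ℓ * ∑ j, (∑ k, u j k * y k) ^ 2) =
          2 * (ℓ:ℝ)⁻¹ * doobF y + 2 * ∑ j, (∑ k, u j k * y k) ^ 2 := by
          field_simp
        rw [e2] at this
        linarith

lemma coord_sq_integrable {n : ℕ} (i : Fin n) : Integrable (fun x : Fin n → ℝ => x i ^ 2) (gv n) := by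
  have := lin_sq_integrable (n := n) (fun q => if q = i then 1 else 0)
  simpa using this

lemma coord_sq_integral {n : ℕ} (i : Fin n) : ∫ x : Fin n → ℝ, x i ^ 2 ∂gv n = 1 := by
  have := lin_sq_integral (n := n) (fun q => if q = i then 1 else 0)
  simpa using this

open Classical in
lemma inCell_card {n : ℕ} (c : ℕ × ℤ) :
    (Finset.univ.filter fun i : Fin n => inCell c i.1).card ≤ 2 ^ c.1 := by
  have h : ((Finset.univ.filter fun i : Fin n => inCell c i.1).image fun i => (i.1 : ℤ)) ⊆
      Finset.Ico (c.2 * 2 ^ c.1) ((c.2 + 1) * 2 ^ c.1) := by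
    intro t ht
    simp only [Finset.mem_image, Finset.mem_filter, Finset.mem_univ, true_and] at ht
    obtain ⟨i, hi, rfl⟩ := ht
    exact Finset.mem_Ico.2 hi
  have h2 := Finset.card_le_card h
  rw [Finset.card_image_of_injective _ (fun a b hab => Fin.ext (by exact_mod_cast hab)), Int.card_Ico] at h2
  have e : ((c.2 + 1) * 2 ^ c.1 - c.2 * 2 ^ c.1 : ℤ) = ((2 ^ c.1 : ℕ) : ℤ) := by push_cast; ring
  rw [e, Int.toNat_natCast] at h2
  exact h2

set_option maxHeartbeats 1000000 in
lemma cellB (r n : ℕ) (hr : 1 ≤ r) (hrn : r ≤ n) (N : Finset ℤ) (M : ℕ) (h0 : (-1 : ℤ) ∈ N)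
    (h1 : ∀ t : ℤ, (n : ℤ) - r ≤ t → t < n → t ∈ N) (m : ℝ) (hm : (2 : ℝ) ^ M ≤ m)
    (c : ℕ × ℤ) (hc : c ∈ cells N M n) (L : ℝ)
    (hL : 25600 * m ^ (2 * (r : ℤ) - 1) * Real.log (Real.exp 1 * m) ≤ L ^ 2) (hL0 : 0 ≤ L) :
    ∃ Y : (Fin n → ℝ) → ℝ, Integrable Y (gv n) ∧ ∫ y, Y y ∂gv n ≤ 16 + 3 * r ∧
    ∀ x : Fin n → ℝ, ∃ (p w : ℤ → ℝ) (b : ℝ),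
      (0 ≤ b ∧ 40 * b ≤ L ∧ (∀ t, ¬ inCell c t → p t = 0) ∧ (∀ t, ¬ inCell c t → w t = 0) ∧
        (∀ t, |w t| ≤ b) ∧ (∀ i : Fin n, inCell c i.1 → x i = p i.1 + (-1) ^ r * (bdL ^ r) w i.1) ∧
        (∀ i : Fin n, ¬ inCell c i.1 → (bdL ^ r) w i.1 = 0) ∧ (¬ (1 ≤ c.1 ∧ r ≤ 2 ^ c.1) → b = 0)) ∧
      ∑ i ∈ Finset.range n, p i ^ 2 + b ^ 2 * ((2 : ℝ) ^ c.1) ^ (1 - 2 * (r : ℤ)) ≤ Y x := by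
  classical
  obtain ⟨hcM, hc0, hcn, -, -⟩ := mem_cells.1 hc
  by_cases hA : 1 ≤ c.1 ∧ r ≤ 2 ^ c.1
  · obtain ⟨hin1, hin2⟩ := cell_inside hrn h0 h1 hr hc hA.1
    have hlm : (((2 ^ c.1 : ℕ)) : ℝ) ≤ m := by
      push_cast
      exact (pow_le_pow_right₀ (by norm_num) hcM).trans hm
    obtain ⟨Y, hYi, hY, hYx⟩ := cellA r (2 ^ c.1) hr hA.2 m hlm
    have hpos : (0 : ℤ) < 2 ^ c.1 := by positivity
    obtain ⟨s, hs⟩ := Int.eq_ofNat_of_zero_le (show 0 ≤ c.2 * 2 ^ c.1 by positivity)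
    have hs' : c.2 * 2 ^ c.1 = (s : ℤ) := hs
    have hsn : s + 2 ^ c.1 ≤ n := by
      have : (s : ℤ) + 2 ^ c.1 ≤ n := by
        rw [← hs']; nlinarith
      exact_mod_cast this
    let φ : Fin (2 ^ c.1) → Fin n := fun i => ⟨s + i.1, by have := i.2; omega⟩
    have hφ : Function.Injective φ := by
      intro a b hab
      have := congrArg Fin.val hab
      simp only [φ] at this
      exact Fin.ext (by omega)
    have hmp := gv_precomp φ hφ
    refine ⟨fun x => Y (fun i => x (φ i)), hmp.integrable_comp_of_integrable hYi, ?_, ?_⟩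
    · have e : ∫ y, Y y ∂gv (2 ^ c.1) = ∫ x : Fin n → ℝ, Y (fun i => x (φ i)) ∂gv n := by
        rw [← hmp.map_eq]
        apply integral_map hmp.measurable.aemeasurable
        rw [hmp.map_eq]; exact hYi.aestronglyMeasurable
      rw [← e]; exact hY
    · intro x
      obtain ⟨p, w, b, hb0, hb, hp, hw, hwb, hx, hbd, hfin⟩ := hYx (fun i => x (φ i))
      have hcell : ∀ t : ℤ, inCell c t ↔ (0 ≤ t - s ∧ t - s < ((2 ^ c.1 : ℕ) : ℤ)) := by
        intro t
        unfold inCell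
        rw [add_mul, one_mul, hs']
        push_cast
        constructor <;> rintro ⟨h1, h2⟩ <;> constructor <;> linarith
      refine ⟨fun t => p (t - s), fun t => w (t - s), b, ⟨hb0, ?_, ?_, ?_, ?_, ?_, ?_, ?_⟩, ?_⟩
      · have hlg : 0 ≤ Real.log (Real.exp 1 * m) := by
          have h1m : 1 ≤ m := le_trans (by exact_mod_cast Nat.one_le_two_pow) hlm
          apply Real.log_nonneg
          have := Real.one_le_exp (show (0:ℝ) ≤ 1 by norm_num)
          nlinarith
        refine le_of_abs_le (abs_le_of_sq_le_sq (le_trans ?_ hL) hL0)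
        have : ((2 ^ c.1 : ℕ) : ℝ) ^ (2 * (r : ℤ) - 1) ≤ m ^ (2 * (r : ℤ) - 1) := by
          obtain ⟨q, hq⟩ := Int.eq_ofNat_of_zero_le (show 0 ≤ 2 * (r : ℤ) - 1 by omega)
          rw [hq]
          simp only [zpow_natCast]
          gcongr
        have := mul_le_mul_of_nonneg_right this hlg
        nlinarith
      · intro t ht; exact hp _ (fun h => ht ((hcell t).2 h))
      · intro t ht; exact hw _ (fun h => ht ((hcell t).2 h))
      · intro t; exact hwb _
      · intro i hi
        obtain ⟨h1, h2⟩ := (hcell _).1 hi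
        have hi2 : i.1 - s < 2 ^ c.1 := by omega
        have := hx ⟨i.1 - s, hi2⟩
        have e : φ ⟨i.1 - s, hi2⟩ = i := Fin.ext (by simp only [φ]; omega)
        simp only [e] at this
        have e2 : ((i.1 - s : ℕ) : ℤ) = (i.1 : ℤ) - s := by omega
        rw [e2] at this
        rw [bd_shift]; exact this
      · intro i hi
        rw [bd_shift]; exact hbd _ (fun h => hi ((hcell _).2 h))
      · intro h; exact absurd hA h
      · have e : ∑ i ∈ Finset.range n, p ((i : ℤ) - s) ^ 2 = ∑ i ∈ Finset.range (2 ^ c.1), p i ^ 2 := by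
          have h1 : Finset.Ico s (s + 2 ^ c.1) ⊆ Finset.range n := by
            intro t ht; rw [Finset.mem_Ico] at ht; rw [Finset.mem_range]; omega
          rw [← Finset.sum_subset h1, Finset.sum_Ico_eq_sum_range]
          · rw [Nat.add_sub_cancel_left]
            refine Finset.sum_congr rfl fun i _ => ?_
            push_cast; rw [add_sub_cancel_left]
          · intro t _ ht
            rw [Finset.mem_Ico] at ht
            rw [hp _ (by omega)]; norm_num
        rw [e]
        push_cast at hfin ⊢
        exact hfin
  · refine ⟨fun x => ∑ i ∈ Finset.univ.filter (fun i : Fin n => inCell c i.1), x i ^ 2,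
      integrable_finsetSum _ fun i _ => coord_sq_integrable i, ?_, ?_⟩
    · rw [integral_finsetSum _ fun i _ => coord_sq_integrable i]
      simp_rw [coord_sq_integral]
      rw [Finset.sum_const, nsmul_eq_mul, mul_one]
      have h2 : 2 ^ c.1 ≤ r := by
        by_cases h : 1 ≤ c.1
        · have : ¬ r ≤ 2 ^ c.1 := fun h' => hA ⟨h, h'⟩
          omega
        · have : c.1 = 0 := by omega
          rw [this]; simpa using hr
      have h3 : (((Finset.univ.filter fun i : Fin n => inCell c i.1).card : ℕ) : ℝ) ≤ r := by
        exact_mod_cast (inCell_card c).trans h2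
      have : (0:ℝ) ≤ r := by positivity
      linarith
    · intro x
      refine ⟨fun t => if inCell c t then extZ x t else 0, 0, 0, ⟨le_rfl, by simpa using hL0, ?_, by simp, by simp, ?_, by simp, by simp⟩, ?_⟩
      · intro t ht; simp [ht]
      · intro i hi; simp [hi, extZ_fin]
      · beta_reduce
        rw [Finset.sum_range, Finset.sum_filter]
        simp only [ne_eq, OfNat.ofNat_ne_zero, not_false_eq_true, zero_pow, zero_mul, add_zero]
        refine Finset.sum_le_sum fun i _ => ?_
        split_ifs
        · rw [extZ_fin]
        · simp

lemma gaussVec_unscale (n : ℕ) (σ : ℝ) (hσ : 0 < σ) :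
    MeasurePreserving (fun (x : Fin n → ℝ) i => σ⁻¹ * x i) (gaussVec n σ) (gv n) := by
  refine ⟨by fun_prop, ?_⟩
  have h := gaussVec_scale n σ
  rw [← h.map_eq, Measure.map_map (by fun_prop) h.measurable]
  have : ((fun (x : Fin n → ℝ) i => σ⁻¹ * x i) ∘ fun (x : Fin n → ℝ) i => σ * x i) = id := by
    funext x i
    simp [hσ.ne']
  rw [this, Measure.map_id]

lemma DD_smul (r : ℕ) {n : ℕ} (c : ℝ) (η : Fin n → ℝ) (t : ℕ) : DD r (c • η) t = c * DD r η t := by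
  have h := DD_add_smul r (0 : Fin n → ℝ) η c t
  have h0 := DD_sub r η η t
  rw [sub_self, sub_self] at h0
  rw [zero_add, h0, zero_add] at h
  exact h

lemma Dl1_smul (r : ℕ) {n : ℕ} (c : ℝ) (hc : 0 ≤ c) (η : Fin n → ℝ) : Dl1 r (c • η) = c * Dl1 r η := by
  unfold Dl1
  simp_rw [DD_smul, abs_mul, abs_of_nonneg hc]
  rw [Finset.mul_sum]

set_option maxHeartbeats 1000000 in
lemma prob_bound (r : ℕ) (hr : 1 ≤ r) : ∃ C : ℝ, 0 < C ∧
    ∀ (n : ℕ), r ≤ n → ∀ (k : ℕ) (τ : ℕ → ℤ) (lam v : ℕ → ℝ),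
    (∀ i ≤ k, τ i < τ (i + 1)) → (∀ i, 1 ≤ lam i) →
    (∀ i ≤ k, (τ i : ℝ) + lam i ≤ τ (i + 1)) → (∀ i, v i = 0 ∨ v i = 1 ∨ v i = -1) →
    v 0 = 0 → v (k + 1) = 0 → τ 0 = -1 → τ (k + 1) = ((n - r : ℕ) : ℤ) →
    ∀ (N : Finset ℤ) (M : ℕ), (∀ i ≤ k + 1, τ i ∈ N) → (∀ i ≤ k, crossing τ lam i ∈ N) →
    (∀ t : ℤ, (n : ℤ) - r ≤ t → t < n → t ∈ N) →
    ∀ θ : Fin n → ℝ,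
    (∀ t : ℕ, t < n - r → DD r θ t ≠ 0 → ∃ i ≤ k, τ i = t ∧ v i * DD r θ t = |DD r θ t|) →
    ∀ (m L : ℝ), (2 : ℝ) ^ M ≤ m → 0 < L →
    25600 * m ^ (2 * (r : ℤ) - 1) * Real.log (Real.exp 1 * m) ≤ L ^ 2 →
    ∀ (σ V : ℝ), 0 < σ → ∀ (θs : Fin n → ℝ) (est : (Fin n → ℝ) → Fin n → ℝ),
    IsProjOn est (Kset r n V) → θ ∈ Kset r n V → (∀ η ∈ Kset r n V, Dl1 r η ≤ Dl1 r θ) →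
    ∫ ξ, sqnorm (est (θs + ξ) - θs) ∂gaussVec n σ ≤ sqnorm (θs - θ) +
      σ ^ 2 * (C * (cells N M n).card + C * L ^ 2 * ∑ i ∈ Finset.range (k + 1),
        if v i ≠ v (i + 1) then lam i ^ (1 - 2 * (r : ℤ)) else 0) := by
  obtain ⟨C0, hC0, hdet⟩ := det_assembly r hr
  refine ⟨C0 * (16 + 3 * r), by positivity, ?_⟩
  intro n hrn k τ lam v hτ hlam hgap hv hv0 hvk hτ0 hτk N M hN1 hN2 hN3 θ hsign m L hM hL0 hL σ V hσ θs est hest hθ hmax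
  have hcell : ∀ c : ℕ × ℤ, ∃ Y : (Fin n → ℝ) → ℝ, c ∈ cells N M n → _ := fun c => by
    by_cases hc : c ∈ cells N M n
    · obtain ⟨Y, hY⟩ := cellB r n hr hrn N M (hτ0 ▸ hN1 0 (by omega)) hN3 m hM c hc L hL hL0.le
      exact ⟨Y, fun _ => hY⟩
    · exact ⟨0, fun h => absurd h hc⟩
  choose Y hY using hcell
  set S := ∑ i ∈ Finset.range (k + 1), if v i ≠ v (i + 1) then lam i ^ (1 - 2 * (r : ℤ)) else 0 with hS
  have hS0 : 0 ≤ S := by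
    apply Finset.sum_nonneg; intro i _
    have := hlam i
    split_ifs <;> positivity
  let G1 : (Fin n → ℝ) → ℝ := fun x => C0 * (∑ c ∈ cells N M n, Y c x) + C0 * L ^ 2 * S
  have hG1i : Integrable G1 (gv n) :=
    ((integrable_finsetSum _ fun c hc => (hY c hc).1).const_mul C0).add (integrable_const _)
  have hG1 : ∫ x, G1 x ∂gv n ≤ C0 * ((16 + 3 * r) * (cells N M n).card) + C0 * L ^ 2 * S := by
    have hi : Integrable (fun x => C0 * (∑ c ∈ cells N M n, Y c x)) (gv n) :=
      (integrable_finsetSum _ fun c hc => (hY c hc).1).const_mul C0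
    simp only [G1]
    rw [integral_add hi (integrable_const _), integral_const_mul, integral_finsetSum _ fun c hc => (hY c hc).1]
    have h1 : ∑ c ∈ cells N M n, ∫ x, Y c x ∂gv n ≤ (16 + 3 * r) * (cells N M n).card := by
      calc _ ≤ ∑ c ∈ cells N M n, (16 + 3 * (r:ℝ)) := Finset.sum_le_sum fun c hc => (hY c hc).2.1
        _ = _ := by rw [Finset.sum_const, nsmul_eq_mul]; ring
    have := mul_le_mul_of_nonneg_left h1 hC0.le
    simp only [integral_const, probReal_univ, one_smul]
    linarith
  have hpath : ∀ ξ : Fin n → ℝ, sqnorm (est (θs + ξ) - θs) ≤ sqnorm (θs - θ) + σ ^ 2 * G1 (fun i => σ⁻¹ * ξ i) := by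
    intro ξ
    set x : Fin n → ℝ := fun i => σ⁻¹ * ξ i with hx
    refine (proj_ineq est hest θ hθ θs ξ).trans ?_
    have hYx : ∀ c, ∃ (p w : ℤ → ℝ) (b : ℝ), c ∈ cells N M n → _ := fun c => by
      by_cases hc : c ∈ cells N M n
      · obtain ⟨p, w, b, h⟩ := (hY c hc).2.2 x
        exact ⟨p, w, b, fun _ => h⟩
      · exact ⟨0, 0, 0, fun h => absurd h hc⟩
    choose p w b hpw using hYx
    have hsi : 0 ≤ σ⁻¹ := (inv_pos.2 hσ).le
    have key := hdet n hrn k τ lam v hτ hlam hgap hv hv0 hvk hτ0 hτk N M hN1 hN2 hN3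
      (σ⁻¹ • θ) (σ⁻¹ • est (θs + ξ)) x (by
        rw [Dl1_smul _ _ hsi, Dl1_smul _ _ hsi]
        exact mul_le_mul_of_nonneg_left (hmax _ (hest _).1) hsi) (by
        intro t ht hne
        rw [DD_smul] at hne ⊢
        obtain ⟨i, hi, h1, h2⟩ := hsign t ht (fun h => hne (by rw [h, mul_zero]))
        refine ⟨i, hi, h1, ?_⟩
        rw [abs_mul, abs_of_nonneg hsi, ← h2]; ring) L hL0 p w b (fun c hc => (hpw c hc).1)
    have hsum : ∑ c ∈ cells N M n, (∑ i ∈ Finset.range n, p c i ^ 2 + b c ^ 2 * ((2:ℝ) ^ c.1) ^ (1 - 2 * (r : ℤ))) ≤ ∑ c ∈ cells N M n, Y c x :=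
      Finset.sum_le_sum fun c hc => (hpw c hc).2
    have e : 2 * ∑ i, ξ i * (est (θs + ξ) - θ) i - ∑ i, (est (θs + ξ) - θ) i ^ 2 =
        σ ^ 2 * (2 * ∑ i, x i * (σ⁻¹ • est (θs + ξ) - σ⁻¹ • θ) i - ∑ i, (σ⁻¹ • est (θs + ξ) - σ⁻¹ • θ) i ^ 2) := by
      have e1 : ∑ i, x i * (σ⁻¹ • est (θs + ξ) - σ⁻¹ • θ) i = (σ⁻¹) ^ 2 * ∑ i, ξ i * (est (θs + ξ) - θ) i := by
        rw [Finset.mul_sum]; refine Finset.sum_congr rfl fun i _ => ?_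
        simp only [hx, Pi.sub_apply, Pi.smul_apply, smul_eq_mul]; ring
      have e2 : ∑ i, (σ⁻¹ • est (θs + ξ) - σ⁻¹ • θ) i ^ 2 = (σ⁻¹) ^ 2 * ∑ i, (est (θs + ξ) - θ) i ^ 2 := by
        rw [Finset.mul_sum]; refine Finset.sum_congr rfl fun i _ => ?_
        simp only [Pi.sub_apply, Pi.smul_apply, smul_eq_mul]; ring
      rw [e1, e2]
      field_simp
    rw [e]
    have := mul_le_mul_of_nonneg_left hsum hC0.le
    have h3 : (2 * ∑ i, x i * (σ⁻¹ • est (θs + ξ) - σ⁻¹ • θ) i - ∑ i, (σ⁻¹ • est (θs + ξ) - σ⁻¹ • θ) i ^ 2) ≤ G1 x := by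
      simp only [G1]; rw [hS]; linarith
    have := mul_le_mul_of_nonneg_left h3 (sq_nonneg σ)
    linarith
  have hmp := gaussVec_unscale n σ hσ
  haveI : IsProbabilityMeasure (gaussVec n σ) := by unfold gaussVec; infer_instance
  have hGi : Integrable (fun ξ : Fin n → ℝ => G1 (fun i => σ⁻¹ * ξ i)) (gaussVec n σ) :=
    hmp.integrable_comp_of_integrable hG1i
  have hGe : ∫ ξ : Fin n → ℝ, G1 (fun i => σ⁻¹ * ξ i) ∂gaussVec n σ = ∫ x, G1 x ∂gv n := by
    symm
    conv_lhs => rw [← hmp.map_eq]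
    apply integral_map hmp.measurable.aemeasurable
    rw [hmp.map_eq]; exact hG1i.aestronglyMeasurable
  calc ∫ ξ, sqnorm (est (θs + ξ) - θs) ∂gaussVec n σ
      ≤ ∫ ξ, (sqnorm (θs - θ) + σ ^ 2 * G1 (fun i => σ⁻¹ * ξ i)) ∂gaussVec n σ := by
        apply integral_mono_of_nonneg
        · exact Filter.Eventually.of_forall fun ξ => by unfold sqnorm; positivity
        · exact (integrable_const _).add (hGi.const_mul _)
        · exact Filter.Eventually.of_forall hpath
    _ = sqnorm (θs - θ) + σ ^ 2 * ∫ x, G1 x ∂gv n := by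
        rw [integral_add (integrable_const _) (hGi.const_mul _), integral_const_mul, hGe]
        simp
    _ ≤ _ := by
        have h1 : C0 * L ^ 2 * S ≤ C0 * (16 + 3 * r) * L ^ 2 * S := by
          have : C0 ≤ C0 * (16 + 3 * r) := by
            have : (0:ℝ) ≤ r := by positivity
            nlinarith
          gcongr
        have : ∫ x, G1 x ∂gv n ≤ C0 * (16 + 3 * r) * (cells N M n).card + C0 * (16 + 3 * r) * L ^ 2 * S := by
          linarith
        gcongr

lemma jext_zero (n r k : ℕ) (j : Fin k → ℕ) : jext n r k j 0 = 1 := by simp [jext]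
lemma jext_succ (n r k : ℕ) (j : Fin k → ℕ) (i : ℕ) (h : i < k) : jext n r k j (i + 1) = j ⟨i, h⟩ := by
  simp [jext, h]
lemma jext_last (n r k : ℕ) (j : Fin k → ℕ) : jext n r k j (k + 1) = n - r + 2 := by
  simp [jext]

lemma jext_lt {n r k : ℕ} {j : Fin k → ℕ} (hj : StrictMono j) (hb : ∀ i, 2 ≤ j i ∧ j i ≤ n - r + 1)
    (i : ℕ) (hi : i ≤ k) : jext n r k j i < jext n r k j (i + 1) := by
  rcases i with _ | i
  · rw [jext_zero]
    by_cases h : 0 < k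
    · rw [jext_succ n r k j 0 h]; have := hb ⟨0, h⟩; omega
    · have : k = 0 := by omega
      subst this
      rw [jext_last]; omega
  · rw [jext_succ n r k j i (by omega)]
    by_cases h : i + 1 < k
    · rw [jext_succ n r k j (i + 1) h]
      exact hj (by simp [Fin.lt_def])
    · have : k = i + 1 := by omega
      subst this
      rw [jext_last]
      have := hb ⟨i, by omega⟩; omega

lemma knots_le {n r k : ℕ} {j : Fin k → ℕ} (hj : StrictMono j) (hb : ∀ i, 2 ≤ j i ∧ j i ≤ n - r + 1) :
    k ≤ n - r := by
  have h1 : (Finset.univ.image j) ⊆ Finset.Icc 2 (n - r + 1) := by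
    intro t ht
    simp only [Finset.mem_image, Finset.mem_univ, true_and] at ht
    obtain ⟨i, rfl⟩ := ht
    exact Finset.mem_Icc.2 (hb i)
  have h2 := Finset.card_le_card h1
  rw [Finset.card_image_of_injective _ hj.injective] at h2
  simp at h2
  omega

lemma DD_step (r : ℕ) (hr : 1 ≤ r) {n : ℕ} (θ : Fin n → ℝ) (t : ℕ) :
    DD r θ t = DD (r - 1) θ (t + 1) - DD (r - 1) θ t := by
  obtain ⟨q, rfl⟩ : ∃ q, r = q + 1 := ⟨r - 1, by omega⟩
  unfold DD
  rw [Function.iterate_succ_apply']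
  rfl

lemma zpow_cmp (r : ℕ) (hr : 1 ≤ r) (a b : ℝ) (ha : 0 < a) (hb : 0 < b) (h : b ≤ r * a) :
    a ^ (1 - 2 * (r : ℤ)) ≤ (r : ℝ) ^ (2 * r - 1) * b ^ (1 - 2 * (r : ℤ)) := by
  have e : (1 - 2 * (r : ℤ)) = -((2 * r - 1 : ℕ) : ℤ) := by omega
  rw [e, zpow_neg, zpow_neg, zpow_natCast, zpow_natCast]
  rw [← div_eq_mul_inv, inv_le_iff_one_le_mul₀ (by positivity), div_mul_eq_mul_div, le_div_iff₀ (by positivity),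
    one_mul, ← mul_pow]
  gcongr

lemma card_bound (r n k M : ℕ) (N : Finset ℤ) (m : ℝ) (hm : m = (n : ℝ) / ((k : ℝ) + 1)) (hm1 : 1 ≤ m)
    (hM : (2:ℝ) ^ M ≤ m) (hM2 : m < (2:ℝ) ^ (M + 1)) (hN : N.card ≤ 2 * k + 3 + r) :
    ((cells N M n).card : ℝ) ≤ (28 * (3 + r) + 3) * ((k + 1) * Real.log (Real.exp 1 * m)) := by
  have hlg : Real.log (Real.exp 1 * m) = 1 + Real.log m := by
    rw [Real.log_mul (Real.exp_pos 1).ne' (by linarith), Real.log_exp]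
  have hl0 := Real.log_nonneg hm1
  have h1 : (M : ℝ) ≤ 2 * Real.log m := by
    have := Real.log_le_log (by positivity) hM
    rw [Real.log_pow] at this
    have h2 := Real.log_two_gt_d9
    have : (0:ℝ) ≤ M := by positivity
    nlinarith
  have h2 : (n : ℝ) / 2 ^ M ≤ 2 * (k + 1) := by
    rw [div_le_iff₀ (by positivity)]
    rw [hm, div_lt_iff₀ (by positivity), pow_succ] at hM2
    linarith
  have h3 : (N.card : ℝ) ≤ (3 + r) * (k + 1) := by
    have : (N.card : ℝ) ≤ 2 * k + 3 + r := by exact_mod_cast hN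
    have : (0:ℝ) ≤ r * k := by positivity
    have : (0:ℝ) ≤ k := by positivity
    nlinarith
  refine (cells_card N M n).trans ?_
  set lg := Real.log (Real.exp 1 * m)
  have hk : (0:ℝ) ≤ k := by positivity
  have h4 : (14 * N.card * M : ℝ) ≤ 14 * ((3 + r) * (k + 1)) * (2 * lg) := by
    have : (M:ℝ) ≤ 2 * lg := by linarith
    gcongr
  have h5 : (2 * ((k:ℝ) + 1) + 1) ≤ 3 * ((k + 1) * lg) := by
    have : (1:ℝ) ≤ lg := by linarith
    nlinarith
  nlinarith

lemma S_bound (r n k : ℕ) (hr : 1 ≤ r) (j : Fin k → ℕ) (sg : Fin k → ℝ) (lam : ℕ → ℝ)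
    (hl : ∀ i, 1 ≤ lam i) (hpos : ∀ i ≤ k, 0 < nstar n r k j i) (hle : ∀ i ≤ k, nstar n r k j i ≤ r * lam i) :
    (∑ i ∈ Finset.range (k + 1), if sgext k sg i ≠ sgext k sg (i + 1) then lam i ^ (1 - 2 * (r : ℤ)) else 0)
      ≤ (r : ℝ) ^ (2 * r - 1) * deltaSq n r k j sg := by
  set f : ℕ → ℝ := fun i => if sgext k sg i ≠ sgext k sg (i + 1) then lam i ^ (1 - 2 * (r : ℤ)) else 0 with hf
  have hl0 : ∀ i, 0 < lam i := fun i => lt_of_lt_of_le one_pos (hl i)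
  have hf0 : ∀ i, 0 ≤ f i := by
    intro i; have := hl0 i; simp only [hf]; split_ifs <;> positivity
  have h1 : ∀ i ≤ k, f i ≤ (r : ℝ) ^ (2 * r - 1) * (if sgext k sg i ≠ sgext k sg (i + 1) then nstar n r k j i ^ (1 - 2 * (r : ℤ)) else 0) := by
    intro i hi
    simp only [hf]
    split_ifs
    · exact zpow_cmp r hr _ _ (hl0 i) (hpos i hi) (hle i hi)
    · simp
  have h2 : ∀ i ≤ k, f i ≤ (r : ℝ) ^ (2 * r - 1) * nstar n r k j i ^ (1 - 2 * (r : ℤ)) := by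
    intro i hi
    have := zpow_cmp r hr _ _ (hl0 i) (hpos i hi) (hle i hi)
    refine le_trans ?_ this
    have := hl0 i
    simp only [hf]
    split_ifs
    · exact le_rfl
    · positivity
  have h3 : ∑ i ∈ Finset.range (k + 1), f i ≤ f 0 + f k + ∑ i ∈ Finset.Ico 1 k, f i := by
    rcases k with _ | k
    · simp [hf0]
    · rw [Finset.sum_range_succ, Finset.range_eq_Ico, Finset.sum_eq_sum_Ico_succ_bot (by omega)]
      simp only [zero_add]
      linarith
  have h4 : ∑ i ∈ Finset.Ico 1 k, f i ≤ (r : ℝ) ^ (2 * r - 1) * ∑ i ∈ Finset.Ico 1 k, (if sgext k sg i ≠ sgext k sg (i + 1) then nstar n r k j i ^ (1 - 2 * (r : ℤ)) else 0) := by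
    rw [Finset.mul_sum]
    exact Finset.sum_le_sum fun i hi => h1 i (by have := (Finset.mem_Ico.1 hi).2; omega)
  unfold deltaSq
  rw [mul_add, mul_add]
  have := h2 0 (by omega)
  have := h2 k le_rfl
  linarith

lemma sgext_vals (k : ℕ) (sg : Fin k → ℝ) (h : ∀ i, sg i = 1 ∨ sg i = -1) (i : ℕ) :
    sgext k sg i = 0 ∨ sgext k sg i = 1 ∨ sgext k sg i = -1 := by
  unfold sgext
  split_ifs with h1
  · exact Or.inr (h _)
  · exact Or.inl rfl

set_option maxHeartbeats 1000000 in
/-- Theorem: sharp oracle inequality for the constrained estimator.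
The infimum form "R ≤ inf over θ with V^{(r)}(θ) = V of [...]" is expressed by quantifying
over every θ with `V^{(r)}(θ) = V`, together with its (uniquely determined) knot data. -/
theorem stmt1 (r : ℕ) (hr : 1 ≤ r) :
    ∃ C : ℝ, 0 < C ∧
      ∀ (n : ℕ), 2 * r ≤ n → ∀ σ : ℝ, 0 < σ → ∀ V : ℝ, 0 ≤ V → ∀ θstar : Fin n → ℝ,
        ∀ est : (Fin n → ℝ) → Fin n → ℝ, IsProjOn est (Kset r n V) →
          ∀ (θ : Fin n → ℝ) (k : ℕ) (j : Fin k → ℕ) (sg : Fin k → ℝ),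
            IsKnotSeq r n θ k j sg → Vr r θ = V →
            risk σ est θstar ≤
              1 / (n : ℝ) * sqnorm (θstar - θ) + C * σ ^ 2 * DeltaR n r k j sg := by
  obtain ⟨C, hC, hprob⟩ := prob_bound r hr
  refine ⟨C * ((28 * (3 + r) + 3) + 25600 * (r : ℝ) ^ (2 * r - 1)), by positivity, ?_⟩
  intro n hn σ hσ V hV θs est hest θ k j sg ⟨hj, hb, hknot, hsg⟩ hVr
  have hrn : r ≤ n := by omega
  have hk := knots_le hj hb
  have hn0 : (0:ℝ) < n := by exact_mod_cast (by omega : 0 < n)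
  set m : ℝ := (n : ℝ) / ((k : ℝ) + 1) with hm
  have hm1 : 1 ≤ m := by
    rw [hm, le_div_iff₀ (by positivity), one_mul]
    exact_mod_cast (by omega : k + 1 ≤ n)
  have hm0 : 0 < m := by linarith
  set lg := Real.log (Real.exp 1 * m) with hlg
  have hlg1 : 1 ≤ lg := by
    rw [hlg, Real.log_mul (Real.exp_pos 1).ne' (by linarith), Real.log_exp]
    have := Real.log_nonneg hm1; linarith
  obtain ⟨M, hM, hM2⟩ := exists_nat_pow_near hm1 (by norm_num : (1:ℝ) < 2)
  set L := Real.sqrt (25600 * m ^ (2 * (r : ℤ) - 1) * lg) with hL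
  have hLp : 0 < 25600 * m ^ (2 * (r : ℤ) - 1) * lg := by positivity
  have hL0 : 0 < L := Real.sqrt_pos.2 hLp
  have hL2 : L ^ 2 = 25600 * m ^ (2 * (r : ℤ) - 1) * lg := Real.sq_sqrt hLp.le
  let τ : ℕ → ℤ := fun i => (jext n r k j i : ℤ) - 2
  let lam : ℕ → ℝ := fun i => if i ≤ k then min ((τ (i + 1) : ℝ) - τ i) m else 1
  have hjl := fun i hi => jext_lt hj hb i hi
  have hτ : ∀ i ≤ k, τ i < τ (i + 1) := by
    intro i hi; have := hjl i hi; simp only [τ]; omega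
  have hτ1 : ∀ i ≤ k, (1:ℝ) ≤ (τ (i + 1) : ℝ) - τ i := by
    intro i hi
    have : (1 : ℤ) ≤ τ (i + 1) - τ i := by have := hτ i hi; omega
    exact_mod_cast this
  have hlam : ∀ i, 1 ≤ lam i := by
    intro i; simp only [lam]
    split_ifs with h
    · exact le_min (hτ1 i h) hm1
    · exact le_rfl
  have hgap : ∀ i ≤ k, (τ i : ℝ) + lam i ≤ τ (i + 1) := by
    intro i hi
    simp only [lam, if_pos hi]
    have := min_le_left ((τ (i + 1) : ℝ) - τ i) m
    linarith
  let N : Finset ℤ := (Finset.range (k + 2)).image τ ∪ (Finset.range (k + 1)).image (crossing τ lam) ∪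
    Finset.Ico ((n : ℤ) - r) n
  have hNc : N.card ≤ 2 * k + 3 + r := by
    have h1 := Finset.card_union_le ((Finset.range (k + 2)).image τ ∪ (Finset.range (k + 1)).image (crossing τ lam)) (Finset.Ico ((n : ℤ) - r) n)
    have h2 := Finset.card_union_le ((Finset.range (k + 2)).image τ) ((Finset.range (k + 1)).image (crossing τ lam))
    have h3 := Finset.card_image_le (s := Finset.range (k + 2)) (f := τ)
    have h4 := Finset.card_image_le (s := Finset.range (k + 1)) (f := crossing τ lam)
    rw [Finset.card_range] at h3 h4
    rw [Int.card_Ico] at h1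
    have : ((n : ℤ) - ((n : ℤ) - r)).toNat = r := by omega
    rw [this] at h1
    show (((Finset.range (k + 2)).image τ ∪ (Finset.range (k + 1)).image (crossing τ lam)) ∪ Finset.Ico ((n : ℤ) - r) n).card ≤ _
    omega
  have hKe : V * (n : ℝ) ^ (1 - (r : ℤ)) = Dl1 r θ := by
    rw [← hVr]; unfold Vr
    have : (n : ℝ) ^ ((r : ℤ) - 1) * (n : ℝ) ^ (1 - (r : ℤ)) = 1 := by
      rw [← zpow_add₀ hn0.ne']; simp
    calc _ = (n : ℝ) ^ ((r : ℤ) - 1) * (n : ℝ) ^ (1 - (r : ℤ)) * Dl1 r θ := by ring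
      _ = _ := by rw [this, one_mul]
  have hθK : θ ∈ Kset r n V := by show Dl1 r θ ≤ _; rw [hKe]
  have hKm : ∀ η ∈ Kset r n V, Dl1 r η ≤ Dl1 r θ := by
    intro η hη
    have : Dl1 r η ≤ V * (n : ℝ) ^ (1 - (r : ℤ)) := hη
    rwa [hKe] at this
  have hsgv : ∀ i, sg i = 1 ∨ sg i = -1 := by
    intro i; rw [hsg]; split_ifs <;> simp
  have hsign : ∀ t : ℕ, t < n - r → DD r θ t ≠ 0 → ∃ i ≤ k, τ i = t ∧ sgext k sg i * DD r θ t = |DD r θ t| := by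
    intro t ht hne
    rw [DD_step r hr] at hne ⊢
    obtain ⟨i, hi⟩ := (hknot (t + 2) (by omega) (by omega)).1 (by
      simp only [Nat.add_sub_cancel, show t + 2 - 1 = t + 1 from rfl]
      intro h; exact hne (by rw [h, sub_self]))
    refine ⟨i.1 + 1, i.2, ?_, ?_⟩
    · simp only [τ]; rw [jext_succ n r k j i.1 i.2, Fin.eta, hi]; push_cast; ring
    · have e : sgext k sg (i.1 + 1) = sg i := by simp [sgext]
      rw [e, hsg i, hi]
      simp only [Nat.add_sub_cancel, show t + 2 - 1 = t + 1 from rfl]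
      split_ifs with h
      · rw [one_mul, abs_of_pos (by linarith)]
      · rw [abs_of_nonpos (by linarith)]; ring
  have main := hprob n hrn k τ lam (sgext k sg) hτ hlam hgap (sgext_vals k sg hsgv)
    (by simp [sgext]) (by simp [sgext]) (by simp only [τ]; rw [jext_zero]; norm_num)
    (by simp only [τ]; rw [jext_last]; push_cast; ring) N M
    (fun i hi => Finset.mem_union_left _ (Finset.mem_union_left _ (Finset.mem_image_of_mem _ (Finset.mem_range.2 (by omega)))))
    (fun i hi => Finset.mem_union_left _ (Finset.mem_union_right _ (Finset.mem_image_of_mem _ (Finset.mem_range.2 (by omega)))))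
    (fun t h1 h2 => Finset.mem_union_right _ (Finset.mem_Ico.2 ⟨h1, h2⟩))
    θ hsign m L hM hL0 hL2.ge σ V hσ θs est hest hθK hKm
  have hr1 : (1:ℝ) ≤ r := by exact_mod_cast hr
  have hnl : ∀ i ≤ k, (0:ℝ) < nlen n r k j i ∧ (nlen n r k j i : ℝ) ≤ r * ((τ (i + 1) : ℝ) - τ i) := by
    intro i hi
    have h1 := hjl i hi
    have e : (τ (i + 1) : ℝ) - τ i = (jext n r k j (i + 1) : ℝ) - jext n r k j i := by
      simp only [τ]; push_cast; ring
    rw [e]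
    rcases i with _ | i
    · rw [jext_zero] at h1 ⊢
      have e2 : nlen n r k j 0 = (jext n r k j 1 - 1) + (r - 1) := by
        simp only [nlen, if_true]; simp only [zero_add] at h1; omega
      have hpos : 0 < nlen n r k j 0 := by rw [e2]; simp only [zero_add] at h1; omega
      refine ⟨by exact_mod_cast hpos, ?_⟩
      rw [e2]
      simp only [zero_add] at h1 ⊢
      have h2 : (2:ℝ) ≤ jext n r k j 1 := by exact_mod_cast h1
      push_cast [Nat.cast_sub (show 1 ≤ jext n r k j 1 by omega), Nat.cast_sub hr]
      nlinarith
    · have e2 : nlen n r k j (i + 1) = jext n r k j (i + 1 + 1) - jext n r k j (i + 1) := by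
        simp [nlen]
      refine ⟨by rw [e2]; exact_mod_cast Nat.sub_pos_of_lt h1, ?_⟩
      rw [e2, Nat.cast_sub h1.le]
      have : (0:ℝ) ≤ (jext n r k j (i + 1 + 1) : ℝ) - jext n r k j (i + 1) := by
        have : (jext n r k j (i + 1) : ℝ) ≤ jext n r k j (i + 1 + 1) := by exact_mod_cast h1.le
        linarith
      nlinarith
  have hSb := S_bound r n k hr j sg lam hlam
    (fun i hi => lt_min (hnl i hi).1 hm0) (fun i hi => by
      simp only [lam, if_pos hi]
      rw [mul_min_of_nonneg _ _ (by linarith)]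
      refine min_le_min (hnl i hi).2 ?_
      show m ≤ r * m
      nlinarith)
  have hCb := card_bound r n k M N m hm hm1 hM hM2 hNc
  rw [← hlg] at hCb
  set S := ∑ i ∈ Finset.range (k + 1), if sgext k sg i ≠ sgext k sg (i + 1) then lam i ^ (1 - 2 * (r : ℤ)) else 0
  set K1 : ℝ := 28 * (3 + r) + 3 with hK1
  set K2 : ℝ := (r : ℝ) ^ (2 * r - 1) with hK2
  have hK10 : 0 ≤ K1 := by positivity
  have hK20 : 0 ≤ K2 := by positivity
  set dsq := deltaSq n r k j sg with hdsq
  have hd0 : 0 ≤ dsq := by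
    have hp : ∀ i ≤ k, 0 < nstar n r k j i := fun i hi => lt_min (hnl i hi).1 hm0
    rw [hdsq]; unfold deltaSq
    have h1 := zpow_pos (hp 0 (by omega)) (1 - 2 * (r : ℤ))
    have h2 := zpow_pos (hp k le_rfl) (1 - 2 * (r : ℤ))
    have h3 : 0 ≤ ∑ i ∈ Finset.Ico 1 k,
        (if sgext k sg i ≠ sgext k sg (i + 1) then nstar n r k j i ^ (1 - 2 * (r : ℤ)) else 0) := by
      apply Finset.sum_nonneg
      intro i hi
      have := zpow_pos (hp i (by have := (Finset.mem_Ico.1 hi).2; omega)) (1 - 2 * (r : ℤ))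
      split_ifs <;> linarith
    linarith
  have hD : ((k + 1) * lg + dsq * m ^ (2 * (r : ℤ) - 1) * lg) / n ≤ DeltaR n r k j sg := by
    unfold DeltaR
    rw [mul_div_assoc, ← hm, ← hlg, ← hdsq]
    have : 0 ≤ (Real.sqrt dsq / Real.sqrt (n : ℝ)) ^ ((1 : ℝ) / (r : ℝ)) := by positivity
    have e : ((k + 1) * lg + dsq * m ^ (2 * (r : ℤ) - 1) * lg) / n =
      ((k : ℝ) + 1) / (n : ℝ) * lg + dsq / (n : ℝ) * m ^ (2 * (r : ℤ) - 1) * lg := by field_simp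
    rw [e]; linarith
  set A := ((k:ℝ) + 1) * lg with hA
  set B := dsq * m ^ (2 * (r : ℤ) - 1) * lg with hB
  have hA0 : 0 ≤ A := by positivity
  have hB0 : 0 ≤ B := by positivity
  have hfin : C * (cells N M n).card + C * L ^ 2 * S ≤ C * (K1 + 25600 * K2) * (A + B) := by
    have h1 : C * (cells N M n).card ≤ C * (K1 * A) := by gcongr
    have h2 : C * L ^ 2 * S ≤ C * L ^ 2 * (K2 * dsq) := by gcongr
    have e : C * L ^ 2 * (K2 * dsq) = C * (25600 * K2 * B) := by rw [hL2, hB]; ring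
    have h3 : C * (K1 + 25600 * K2) * (A + B) = C * (K1 * A) + C * (25600 * K2 * B) + C * (K1 * B) + C * (25600 * K2 * A) := by ring
    have h4 : 0 ≤ C * (K1 * B) := by positivity
    have h5 : 0 ≤ C * (25600 * K2 * A) := by positivity
    linarith
  unfold risk
  calc _ ≤ 1 / (n:ℝ) * (sqnorm (θs - θ) + σ ^ 2 * (C * (K1 + 25600 * K2) * (A + B))) := by
        refine mul_le_mul_of_nonneg_left (main.trans ?_) (by positivity)
        gcongr
    _ = 1 / (n:ℝ) * sqnorm (θs - θ) + C * (K1 + 25600 * K2) * σ ^ 2 * ((A + B) / n) := by ring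
    _ ≤ _ := by gcongr

end
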